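/- Let ξ ∈ F_q((T^{-1})) and n a positive integer. Then w_n^*(ξ) = w_n^*(ξ^p), where p is the characteristic. -/

import Mathlib

open Polynomial
open scoped Classical

namespace MahlerKoksmaFq

noncomputable section

variable (Fq : Type) [Field Fq] [Fintype Fq]

/-- `K Fq` models `F_q((T⁻¹))`: Laurent series in the variable `t = T⁻¹`. -/
abbrev K := LaurentSeries Fq

/-- The element `T` (the inverse of the Laurent-series variable `t = T⁻¹`). -/
def Tvar : K Fq := HahnSeries.single (-1 : ℤ) 1

/-- The absolute value `|ξ| = q^{-ν(ξ)}` on `F_q((T⁻¹))`. -/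
def absK (ξ : K Fq) : ℝ :=
  if ξ = 0 then 0 else (Fintype.card Fq : ℝ) ^ (-(HahnSeries.order ξ))

/-- The embedding of `F_q[T]` into `F_q((T⁻¹))`, sending `T` to `Tvar`. -/
def emb : Polynomial Fq →+* K Fq :=
  Polynomial.eval₂RingHom (algebraMap Fq (K Fq)) (Tvar Fq)

/-- Evaluation of `P ∈ F_q[T][X]` at `ξ ∈ F_q((T⁻¹))`. -/
def evalK (P : Polynomial (Polynomial Fq)) (ξ : K Fq) : K Fq :=
  P.eval₂ (emb Fq) ξ

/-- Height of a polynomial over `F_q[T]`: the maximum of the absolute values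
`q^{deg c}` of its coefficients. -/
def HP (P : Polynomial (Polynomial Fq)) : ℝ :=
  (Fintype.card Fq : ℝ) ^ (P.support.sup fun i => (P.coeff i).natDegree)

/-- `ξ` is algebraic (over `F_q[T]`) of degree at most `n`. -/
def IsAlgDegLe (ξ : K Fq) (n : ℕ) : Prop :=
  ∃ P : Polynomial (Polynomial Fq), P ≠ 0 ∧ P.natDegree ≤ n ∧ evalK Fq P ξ = 0

/-- `ξ` is algebraic over `F_q[T]`. -/
def IsAlgK (ξ : K Fq) : Prop :=
  ∃ P : Polynomial (Polynomial Fq), P ≠ 0 ∧ evalK Fq P ξ = 0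

/-- The degree of an algebraic element of `F_q((T⁻¹))`. -/
def degA (α : K Fq) : ℕ :=
  sInf {d | ∃ P : Polynomial (Polynomial Fq), P ≠ 0 ∧ P.natDegree = d ∧ evalK Fq P α = 0}

/-- The height of an algebraic element `α` of `F_q((T⁻¹))`: the least height of a
 nonzero annihilating polynomial of minimal degree (= height of the minimal
 defining polynomial over `F_q[T]`). -/
def HA (α : K Fq) : ℝ :=
  sInf {h | ∃ P : Polynomial (Polynomial Fq),
    P ≠ 0 ∧ P.natDegree = degA Fq α ∧ evalK Fq P α = 0 ∧ h = HP Fq P}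

/-- The defining set for Mahler's exponent `w_n`. -/
def wnSet (ξ : K Fq) (n : ℕ) : Set ℝ :=
  {w | {P : Polynomial (Polynomial Fq) |
      P.natDegree ≤ n ∧ 0 < absK Fq (evalK Fq P ξ) ∧
      absK Fq (evalK Fq P ξ) < HP Fq P ^ (-w)}.Infinite}

/-- Mahler's exponent `w_n(ξ)`. -/
def wn (ξ : K Fq) (n : ℕ) : EReal :=
  sSup ((fun w : ℝ => (w : EReal)) '' wnSet Fq ξ n)

/-- The defining set for `w_n^{sep}` (separable polynomials only). -/
def wnsepSet (ξ : K Fq) (n : ℕ) : Set ℝ :=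
  {w | {P : Polynomial (Polynomial Fq) |
      P.Separable ∧ P.natDegree ≤ n ∧ 0 < absK Fq (evalK Fq P ξ) ∧
      absK Fq (evalK Fq P ξ) < HP Fq P ^ (-w)}.Infinite}

/-- The exponent `w_n^{sep}(ξ)`. -/
def wnsep (ξ : K Fq) (n : ℕ) : EReal :=
  sSup ((fun w : ℝ => (w : EReal)) '' wnsepSet Fq ξ n)

/-- The defining set for Koksma's exponent `w_n^*` (approximation by algebraic
elements lying in `F_q((T⁻¹))`). -/
def wnstarSet (ξ : K Fq) (n : ℕ) : Set ℝ :=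
  {w | {α : K Fq | IsAlgK Fq α ∧ degA Fq α ≤ n ∧ 0 < absK Fq (ξ - α) ∧
      absK Fq (ξ - α) < HA Fq α ^ (-w - 1)}.Infinite}

/-- Koksma's exponent `w_n^*(ξ)`. -/
def wnstar (ξ : K Fq) (n : ℕ) : EReal :=
  sSup ((fun w : ℝ => (w : EReal)) '' wnstarSet Fq ξ n)

/-- The defining set for the uniform exponent `ŵ_n`. -/
def hwnSet (ξ : K Fq) (n : ℕ) : Set ℝ :=
  {w | ∃ H0 : ℝ, ∀ H : ℝ, H0 < H → ∃ P : Polynomial (Polynomial Fq),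
      P.natDegree ≤ n ∧ HP Fq P ≤ H ∧ 0 < absK Fq (evalK Fq P ξ) ∧
      absK Fq (evalK Fq P ξ) < H ^ (-w)}

/-- The uniform exponent `ŵ_n(ξ)`. -/
def hwn (ξ : K Fq) (n : ℕ) : EReal :=
  sSup ((fun w : ℝ => (w : EReal)) '' hwnSet Fq ξ n)

/-- The defining set for the uniform exponent `ŵ_n^{sep}` (separable polynomials only). -/
def hwnsepSet (ξ : K Fq) (n : ℕ) : Set ℝ :=
  {w | ∃ H0 : ℝ, ∀ H : ℝ, H0 < H → ∃ P : Polynomial (Polynomial Fq),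
      P.Separable ∧ P.natDegree ≤ n ∧ HP Fq P ≤ H ∧ 0 < absK Fq (evalK Fq P ξ) ∧
      absK Fq (evalK Fq P ξ) < H ^ (-w)}

/-- The uniform exponent `ŵ_n^{sep}(ξ)`. -/
def hwnsep (ξ : K Fq) (n : ℕ) : EReal :=
  sSup ((fun w : ℝ => (w : EReal)) '' hwnsepSet Fq ξ n)

/-- The fractional part of a Laurent series in `T⁻¹`: the part with only
 negative powers of `T` (positive powers of the series variable `t = T⁻¹`). -/
def fracPart (η : K Fq) : K Fq :=
  { coeff := fun m => if 0 < m then η.coeff m else 0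
    isPWO_support' := η.isPWO_support'.mono (fun m hm => by
      by_cases h : 0 < m
      · simpa [Function.mem_support, h] using hm
      · simp [Function.mem_support, h] at hm) }

/-- The fractional-part norm `‖η‖ = |η - [η]|`. -/
def fracNorm (η : K Fq) : ℝ := absK Fq (fracPart Fq η)

/-- `max{‖R(T)ξ‖, …, ‖R(T)ξⁿ‖}`. -/
def maxFrac (ξ : K Fq) (n : ℕ) (R : Polynomial Fq) : ℝ :=
  sSup ((fun i => fracNorm Fq (emb Fq R * ξ ^ i)) '' Set.Icc 1 n)

/-- The defining set for the exponent of simultaneous approximation `λ_n`. -/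
def lamSet (ξ : K Fq) (n : ℕ) : Set ℝ :=
  {l | {R : Polynomial Fq | 0 < maxFrac Fq ξ n R ∧
      maxFrac Fq ξ n R < (Fintype.card Fq : ℝ) ^ (-(l * R.natDegree))}.Infinite}

/-- The exponent of simultaneous approximation `λ_n(ξ)`. -/
def lam (ξ : K Fq) (n : ℕ) : EReal :=
  sSup ((fun w : ℝ => (w : EReal)) '' lamSet Fq ξ n)

/-- The defining set for the uniform exponent `λ̂_n`. -/
def hlamSet (ξ : K Fq) (n : ℕ) : Set ℝ :=
  {l | ∃ d0 : ℕ, ∀ d : ℕ, d0 < d → ∃ R : Polynomial Fq, R.natDegree ≤ d ∧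
      0 < maxFrac Fq ξ n R ∧
      maxFrac Fq ξ n R < (Fintype.card Fq : ℝ) ^ (-(l * d))}

/-- The uniform exponent `λ̂_n(ξ)`. -/
def hlam (ξ : K Fq) (n : ℕ) : EReal :=
  sSup ((fun w : ℝ => (w : EReal)) '' hlamSet Fq ξ n)

/-- An algebraic closure of `F_q((T⁻¹))`; its algebraic elements are exactly the
algebraic elements of the completion `C_∞`. -/
abbrev Kbar := AlgebraicClosure (K Fq)

/-- The embedding of `F_q[T]` into the algebraic closure. -/
def embbar : Polynomial Fq →+* Kbar Fq :=
  (algebraMap (K Fq) (Kbar Fq)).comp (emb Fq)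

/-- Evaluation of `P ∈ F_q[T][X]` at a point of the algebraic closure. -/
def evalKbar (P : Polynomial (Polynomial Fq)) (x : Kbar Fq) : Kbar Fq :=
  P.eval₂ (embbar Fq) x

/-- The unique extension of the absolute value of `F_q((T⁻¹))` to its algebraic
closure: `|x| = |N(x)|^{1/d} = |a_0|^{1/d}` where `a_0` is the constant term and
`d` the degree of the minimal polynomial of `x` over `F_q((T⁻¹))`. -/
def absC (x : Kbar Fq) : ℝ :=
  absK Fq ((minpoly (K Fq) x).coeff 0) ^ ((1 : ℝ) / (minpoly (K Fq) x).natDegree)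

/-- `x ∈ C_∞` is algebraic over `F_q[T]`. -/
def IsAlgKbar (x : Kbar Fq) : Prop :=
  ∃ P : Polynomial (Polynomial Fq), P ≠ 0 ∧ evalKbar Fq P x = 0

/-- Degree over `F_q[T]` of an algebraic element of `C_∞`. -/
def degAbar (x : Kbar Fq) : ℕ :=
  sInf {d | ∃ P : Polynomial (Polynomial Fq), P ≠ 0 ∧ P.natDegree = d ∧ evalKbar Fq P x = 0}

/-- Height of an algebraic element of `C_∞`. -/
def HAbar (x : Kbar Fq) : ℝ :=
  sInf {h | ∃ P : Polynomial (Polynomial Fq),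
    P ≠ 0 ∧ P.natDegree = degAbar Fq x ∧ evalKbar Fq P x = 0 ∧ h = HP Fq P}

/-- The defining set for the exponent `w_n^@` (approximation by algebraic
elements of `C_∞`). -/
def wnAtSet (ξ : K Fq) (n : ℕ) : Set ℝ :=
  {w | {α : Kbar Fq | IsAlgKbar Fq α ∧ degAbar Fq α ≤ n ∧
      0 < absC Fq (algebraMap (K Fq) (Kbar Fq) ξ - α) ∧
      absC Fq (algebraMap (K Fq) (Kbar Fq) ξ - α) < HAbar Fq α ^ (-w - 1)}.Infinite}

/-- The exponent `w_n^@(ξ)`. -/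
def wnAt (ξ : K Fq) (n : ℕ) : EReal :=
  sSup ((fun w : ℝ => (w : EReal)) '' wnAtSet Fq ξ n)

/-- The defining set for the uniform exponent `ŵ_n^@`. -/
def hwnAtSet (ξ : K Fq) (n : ℕ) : Set ℝ :=
  {w | ∃ H0 : ℝ, ∀ H : ℝ, H0 < H → ∃ α : Kbar Fq, IsAlgKbar Fq α ∧ degAbar Fq α ≤ n ∧
      HAbar Fq α ≤ H ∧ 0 < absC Fq (algebraMap (K Fq) (Kbar Fq) ξ - α) ∧
      absC Fq (algebraMap (K Fq) (Kbar Fq) ξ - α) < (HAbar Fq α)⁻¹ * H ^ (-w)}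

/-- The uniform exponent `ŵ_n^@(ξ)`. -/
def hwnAt (ξ : K Fq) (n : ℕ) : EReal :=
  sSup ((fun w : ℝ => (w : EReal)) '' hwnAtSet Fq ξ n)

/-- `w(ξ) = limsup_n w_n(ξ)/n`. -/
def wlim (ξ : K Fq) : EReal :=
  Filter.atTop.limsup fun n : ℕ => wn Fq ξ n * (((n : ℝ)⁻¹ : ℝ) : EReal)

/-- `w^*(ξ) = limsup_n w_n^*(ξ)/n`. -/
def wlimstar (ξ : K Fq) : EReal :=
  Filter.atTop.limsup fun n : ℕ => wnstar Fq ξ n * (((n : ℝ)⁻¹ : ℝ) : EReal)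

/-- Height of a polynomial over `C_∞`: maximum of the absolute values of its
coefficients. -/
def HC (P : Polynomial (Kbar Fq)) : ℝ :=
  sSup ((fun i => absC Fq (P.coeff i)) '' Set.Iic P.natDegree)


set_option linter.unusedSectionVars false

/-! ### Basic facts on `absK` -/

lemma one_lt_q : (1 : ℝ) < (Fintype.card Fq : ℝ) := by
  exact_mod_cast Fintype.one_lt_card

lemma absK_le_iff (x : K Fq) (m : ℤ) :
    absK Fq x ≤ (Fintype.card Fq : ℝ) ^ (-m) ↔ ∀ j < m, x.coeff j = 0 := by
  have hq := one_lt_q Fq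
  unfold absK
  split_ifs with h
  · subst h
    simp only [HahnSeries.coeff_zero, implies_true, iff_true]
    positivity
  · rw [zpow_le_zpow_iff_right₀ hq]
    constructor
    · intro hm j hj
      exact HahnSeries.coeff_eq_zero_of_lt_order (by linarith)
    · intro hm
      by_contra hlt
      push Not at hlt
      have := hm x.order (by linarith)
      exact h (HahnSeries.coeff_order_eq_zero.mp this)

lemma absK_nonneg (x : K Fq) : 0 ≤ absK Fq x := by
  unfold absK; split_ifs <;> positivity

lemma absK_zero : absK Fq 0 = 0 := by simp [absK]

lemma absK_pos {x : K Fq} (h : x ≠ 0) : 0 < absK Fq x := by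
  have hq := one_lt_q Fq
  rw [absK, if_neg h]; positivity

lemma absK_of_ne {x : K Fq} (h : x ≠ 0) :
    absK Fq x = (Fintype.card Fq : ℝ) ^ (-(HahnSeries.order x)) := if_neg h

lemma absK_mul (x y : K Fq) : absK Fq (x * y) = absK Fq x * absK Fq y := by
  by_cases hx : x = 0
  · simp [hx, absK_zero]
  by_cases hy : y = 0
  · simp [hy, absK_zero]
  have hq := one_lt_q Fq
  rw [absK_of_ne Fq hx, absK_of_ne Fq hy, absK_of_ne Fq (mul_ne_zero hx hy),
    HahnSeries.order_mul hx hy, neg_add, zpow_add₀ (by positivity)]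

lemma absK_add (x y : K Fq) : absK Fq (x + y) ≤ max (absK Fq x) (absK Fq y) := by
  by_cases hx : x = 0
  · simp [hx]
  by_cases hy : y = 0
  · simp [hy]
  have hq := one_lt_q Fq
  have key : ∀ m : ℤ, m ≤ x.order → m ≤ y.order →
      absK Fq (x + y) ≤ (Fintype.card Fq : ℝ) ^ (-m) := by
    intro m h1 h2
    rw [absK_le_iff]
    intro j hj
    rw [HahnSeries.coeff_add, HahnSeries.coeff_eq_zero_of_lt_order (by linarith),
      HahnSeries.coeff_eq_zero_of_lt_order (by linarith), add_zero]
  rcases le_total x.order y.order with h | h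
  · exact (key _ le_rfl h).trans ((absK_of_ne Fq hx).symm.le.trans (le_max_left _ _))
  · exact (key _ h le_rfl).trans ((absK_of_ne Fq hy).symm.le.trans (le_max_right _ _))

/-- `absK` as an absolute value. -/
def vK : AbsoluteValue (K Fq) ℝ where
  toFun := absK Fq
  map_mul' := absK_mul Fq
  nonneg' := absK_nonneg Fq
  eq_zero' x := by
    constructor
    · intro h; by_contra h0; exact (absK_pos Fq h0).ne' h
    · rintro rfl; exact absK_zero Fq
  add_le' x y := (absK_add Fq x y).trans
    (max_le_add_of_nonneg (absK_nonneg Fq x) (absK_nonneg Fq y))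

lemma vK_apply (x : K Fq) : vK Fq x = absK Fq x := rfl

lemma vK_na : IsNonarchimedean (vK Fq) := fun x y => absK_add Fq x y

lemma Tvar_pow (k : ℕ) : Tvar Fq ^ k = HahnSeries.single (-(k : ℤ)) 1 := by
  rw [Tvar, HahnSeries.single_pow]; simp

lemma emb_monomial (k : ℕ) (c : Fq) :
    emb Fq (monomial k c) = HahnSeries.single (-(k : ℤ)) c := by
  rw [emb, Polynomial.coe_eval₂RingHom, eval₂_monomial, Tvar_pow]
  have h1 : algebraMap Fq (K Fq) c = HahnSeries.single 0 c := by
    rw [LaurentSeries.algebraMap_apply]; rfl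
  rw [h1, HahnSeries.single_mul_single]
  simp

lemma coeff_emb (A : Fq[X]) (m : ℤ) :
    (emb Fq A).coeff m = if m ≤ 0 then A.coeff (-m).toNat else 0 := by
  induction A using Polynomial.induction_on' with
  | add p q hp hq =>
    rw [map_add, HahnSeries.coeff_add, hp, hq]; split_ifs <;> simp
  | monomial k c =>
    rw [emb_monomial, HahnSeries.coeff_single, coeff_monomial]
    split_ifs <;> first | rfl | omega

lemma absK_emb {A : Fq[X]} (hA : A ≠ 0) :
    absK Fq (emb Fq A) = (Fintype.card Fq : ℝ) ^ A.natDegree := by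
  have hq := one_lt_q Fq
  have hc : (emb Fq A).coeff (-(A.natDegree : ℤ)) ≠ 0 := by
    rw [coeff_emb, if_pos (by omega)]
    simpa using hA
  have h0 : emb Fq A ≠ 0 := by
    intro h; rw [h] at hc; simp at hc
  have h1 : absK Fq (emb Fq A) ≤ (Fintype.card Fq : ℝ) ^ (-(-(A.natDegree : ℤ))) := by
    rw [absK_le_iff]
    intro j hj
    rw [coeff_emb, if_pos (by omega)]
    exact coeff_eq_zero_of_natDegree_lt (by omega)
  rw [neg_neg, zpow_natCast] at h1
  refine le_antisymm h1 ?_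
  rw [absK_of_ne Fq h0, ← zpow_natCast, zpow_le_zpow_iff_right₀ hq]
  have := HahnSeries.order_le_of_coeff_ne_zero hc
  omega

lemma emb_injective : Function.Injective (emb Fq) := by
  rw [injective_iff_map_eq_zero]
  intro A hA
  by_contra h
  have := absK_emb Fq h
  rw [hA, absK_zero] at this
  have hq := one_lt_q Fq
  have : (0 : ℝ) < (Fintype.card Fq : ℝ) ^ A.natDegree := by positivity
  linarith

lemma absK_emb_le (A : Fq[X]) : absK Fq (emb Fq A) ≤ (Fintype.card Fq : ℝ) ^ A.natDegree := by
  by_cases h : A = 0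
  · rw [h, map_zero, absK_zero]; positivity
  · exact (absK_emb Fq h).le

lemma one_le_absK_emb {A : Fq[X]} (hA : A ≠ 0) : 1 ≤ absK Fq (emb Fq A) := by
  rw [absK_emb Fq hA]; exact one_le_pow₀ (one_lt_q Fq).le

/-- The `T`-degree of a polynomial. -/
def ht (P : Fq[X][X]) : ℕ := P.support.sup fun i => (P.coeff i).natDegree

lemma HP_eq (P : Fq[X][X]) : HP Fq P = (Fintype.card Fq : ℝ) ^ ht Fq P := rfl

lemma natDegree_coeff_le_ht (P : Fq[X][X]) (i : ℕ) : (P.coeff i).natDegree ≤ ht Fq P := by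
  by_cases h : i ∈ P.support
  · exact Finset.le_sup (f := fun i => (P.coeff i).natDegree) h
  · rw [notMem_support_iff.mp h]; simp

lemma ht_le {P : Fq[X][X]} {D : ℕ} (h : ∀ i, (P.coeff i).natDegree ≤ D) : ht Fq P ≤ D :=
  Finset.sup_le fun i _ => h i

lemma HP_eq_gauss {P : Fq[X][X]} (hP : P ≠ 0) :
    HP Fq P = (P.map (emb Fq)).gaussNorm (vK Fq) 1 := by
  have hq := one_lt_q Fq
  apply le_antisymm
  · rw [HP_eq]
    obtain ⟨i, hi, hi'⟩ := Finset.exists_mem_eq_sup P.support (support_nonempty.mpr hP)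
      (fun i => (P.coeff i).natDegree)
    have h1 := Polynomial.le_gaussNorm (vK Fq) (p := P.map (emb Fq)) (c := 1) zero_le_one i
    rw [coeff_map, vK_apply, absK_emb Fq (mem_support_iff.mp hi), one_pow, mul_one] at h1
    rw [ht, hi']; exact h1
  · obtain ⟨i, hi⟩ := Polynomial.exists_eq_gaussNorm (vK Fq) 1 (P.map (emb Fq))
    rw [hi, one_pow, mul_one, coeff_map, vK_apply, HP_eq]
    exact (absK_emb_le Fq _).trans (pow_le_pow_right₀ hq.le (natDegree_coeff_le_ht Fq P i))

lemma HP_mul {A B : Fq[X][X]} (hA : A ≠ 0) (hB : B ≠ 0) :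
    HP Fq (A * B) = HP Fq A * HP Fq B := by
  rw [HP_eq_gauss Fq hA, HP_eq_gauss Fq hB, HP_eq_gauss Fq (mul_ne_zero hA hB),
    Polynomial.map_mul, Polynomial.gaussNorm_mul (vK_na Fq)]
  all_goals norm_num

lemma ht_mul {A B : Fq[X][X]} (hA : A ≠ 0) (hB : B ≠ 0) :
    ht Fq (A * B) = ht Fq A + ht Fq B := by
  have h := HP_mul Fq hA hB
  rw [HP_eq, HP_eq, HP_eq, ← pow_add] at h
  exact pow_right_injective₀ (by linarith [one_lt_q Fq]) (one_lt_q Fq).ne' h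

lemma ht_le_of_dvd {A P : Fq[X][X]} (hP : P ≠ 0) (h : A ∣ P) : ht Fq A ≤ ht Fq P := by
  obtain ⟨B, rfl⟩ := h
  rw [ht_mul Fq (left_ne_zero_of_mul hP) (right_ne_zero_of_mul hP)]
  omega

lemma one_le_HP (P : Fq[X][X]) : 1 ≤ HP Fq P := one_le_pow₀ (one_lt_q Fq).le


/-! ### Completeness and extension of the absolute value to an algebraic closure -/

lemma absK_lt_succ_iff (x : K Fq) (m : ℤ) :
    absK Fq x < (Fintype.card Fq : ℝ) ^ (-m) ↔ ∀ j ≤ m, x.coeff j = 0 := by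
  have hq := one_lt_q Fq
  constructor
  · intro h j hj
    by_contra h0
    have hx : x ≠ 0 := by rintro rfl; simp at h0
    rw [absK_of_ne Fq hx, zpow_lt_zpow_iff_right₀ hq] at h
    have := HahnSeries.order_le_of_coeff_ne_zero h0
    omega
  · intro h
    have : absK Fq x ≤ (Fintype.card Fq : ℝ) ^ (-(m + 1)) := by
      rw [absK_le_iff]
      exact fun j hj => h j (by omega)
    exact this.trans_lt (zpow_lt_zpow_right₀ hq (by omega))

lemma absK_sub_comm (x y : K Fq) : absK Fq (x - y) = absK Fq (y - x) := (vK Fq).map_sub x y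

/-- A copy of `K` carrying only the field structure and the norm. -/
def KN := K Fq

instance : Field (KN Fq) := inferInstanceAs (Field (K Fq))

/-- The identity, from `KN` to `K`. -/
def ofKN : KN Fq ≃+* K Fq := RingEquiv.refl (K Fq)

instance instNormedFieldKN : NormedField (KN Fq) where
  norm x := absK Fq (ofKN Fq x)
  dist x y := absK Fq (ofKN Fq x - ofKN Fq y)
  dist_self x := by rw [sub_self, absK_zero]
  dist_comm x y := absK_sub_comm Fq _ _
  dist_triangle x y z := (vK Fq).sub_le _ _ _
  eq_of_dist_eq_zero {x y} h := by
    have : (vK Fq) (ofKN Fq x - ofKN Fq y) = 0 := h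
    exact (ofKN Fq).injective (sub_eq_zero.mp ((vK Fq).eq_zero.mp this))
  dist_eq x y := by
    change absK Fq (ofKN Fq x - ofKN Fq y) = absK Fq (ofKN Fq (-x + y))
    rw [absK_sub_comm, map_add, map_neg]; congr 1; ring
  norm_mul x y := by rw [map_mul, absK_mul]

lemma norm_KN (x : KN Fq) : ‖x‖ = absK Fq (ofKN Fq x) := rfl

lemma absK_Tvar : absK Fq (Tvar Fq) = Fintype.card Fq := by
  have h : emb Fq X = Tvar Fq := by rw [emb, coe_eval₂RingHom, eval₂_X]
  rw [← h, absK_emb Fq X_ne_zero, natDegree_X, pow_one]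

instance instNNF : NontriviallyNormedField (KN Fq) where
  non_trivial := ⟨(ofKN Fq).symm (Tvar Fq), by
    rw [norm_KN, RingEquiv.apply_symm_apply, absK_Tvar]; exact one_lt_q Fq⟩

instance : IsUltrametricDist (KN Fq) :=
  IsUltrametricDist.isUltrametricDist_of_forall_norm_add_le_max_norm
    (fun x y => by rw [norm_KN, map_add]; exact absK_add Fq _ _)

instance : CompleteSpace (KN Fq) := by
  have hq := one_lt_q Fq
  apply Metric.complete_of_cauchySeq_tendsto
  intro u hu
  have h1 : ∀ m : ℤ, ∃ N, ∀ i ≥ N, ∀ j ≥ N, absK Fq (ofKN Fq (u i) - ofKN Fq (u j)) <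
      (Fintype.card Fq : ℝ) ^ (-m) := by
    intro m
    obtain ⟨N, hN⟩ := Metric.cauchySeq_iff.mp hu ((Fintype.card Fq : ℝ) ^ (-m)) (by positivity)
    exact ⟨N, hN⟩
  choose N hN using h1
  have hcoef : ∀ m : ℤ, ∀ i ≥ N m, ∀ j ≥ N m, ∀ k ≤ m,
      (ofKN Fq (u i)).coeff k = (ofKN Fq (u j)).coeff k := by
    intro m i hi j hj k hk
    have := (absK_lt_succ_iff Fq _ m).mp (hN m i hi j hj) k hk
    rw [HahnSeries.coeff_sub] at this
    exact sub_eq_zero.mp this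
  let f : ℤ → Fq := fun m => (ofKN Fq (u (N m))).coeff m
  have hf : ∀ m : ℤ, ∀ i ≥ N m, ∀ k ≤ m, f k = (ofKN Fq (u i)).coeff k := by
    intro m i hi k hk
    change (ofKN Fq (u (N k))).coeff k = _
    rw [hcoef k (N k) le_rfl (max (N k) i) (le_max_left _ _) k le_rfl]
    exact hcoef m _ (hi.trans (le_max_right _ _)) _ hi k hk
  have hbd : BddBelow (Function.support f) := by
    refine ⟨min 0 (HahnSeries.order (ofKN Fq (u (N 0)))), ?_⟩
    intro m hm
    by_contra hlt
    push Not at hlt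
    rw [lt_min_iff] at hlt
    apply hm
    rw [hf 0 (N 0) le_rfl m hlt.1.le]
    exact HahnSeries.coeff_eq_zero_of_lt_order hlt.2
  let a : K Fq := HahnSeries.ofSuppBddBelow f hbd
  refine ⟨(ofKN Fq).symm a, ?_⟩
  rw [Metric.tendsto_atTop]
  intro ε hε
  obtain ⟨k, hk⟩ := exists_pow_lt_of_lt_one hε (inv_lt_one_of_one_lt₀ hq)
  refine ⟨N k, fun i hi => ?_⟩
  change absK Fq (ofKN Fq (u i) - ofKN Fq ((ofKN Fq).symm a)) < ε
  rw [RingEquiv.apply_symm_apply]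
  have : absK Fq (ofKN Fq (u i) - a) < (Fintype.card Fq : ℝ) ^ (-(k : ℤ)) := by
    rw [absK_lt_succ_iff]
    intro j hj
    rw [HahnSeries.coeff_sub]
    have := hf k i hi j hj
    rw [← this]
    exact sub_self _
  refine this.trans ?_
  rwa [zpow_neg, zpow_natCast, ← inv_pow]

lemma exists_extension : ∃ (L : Type) (_ : Field L) (_ : Algebra (K Fq) L) (vL : AbsoluteValue L ℝ),
    IsAlgClosed L ∧ IsNonarchimedean vL ∧ ∀ x : K Fq, vL (algebraMap (K Fq) L x) = absK Fq x := by
  let L := AlgebraicClosure (KN Fq)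
  let vL : AbsoluteValue L ℝ :=
    { toFun := spectralNorm (KN Fq) L
      map_mul' := map_mul (spectralMulAlgNorm (KN Fq) L)
      nonneg' := spectralNorm_nonneg
      eq_zero' := fun x => by
        constructor
        · intro h
          by_contra h0
          exact (spectralNorm_zero_lt h0 (Algebra.IsAlgebraic.isAlgebraic x)).ne' h
        · rintro rfl; exact spectralNorm_zero
      add_le' := map_add_le_add (spectralMulAlgNorm (KN Fq) L) }
  refine ⟨L, inferInstance, ((algebraMap (KN Fq) L).comp (ofKN Fq).symm.toRingHom).toAlgebra, vL,
    inferInstance, ?_, ?_⟩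
  · exact isNonarchimedean_spectralNorm
  · intro x
    have := spectralNorm_extends (L := L) ((ofKN Fq).symm x)
    rw [norm_KN, RingEquiv.apply_symm_apply] at this
    exact this


/-! ### Hensel's lemma -/

lemma exists_powerSeries {x : K Fq} (hx : absK Fq x < 1) :
    ∃ c : PowerSeries Fq, HahnSeries.ofPowerSeries ℤ Fq c = x ∧
      c ∈ Ideal.span {(PowerSeries.X : PowerSeries Fq)} := by
  have h0 : ∀ j ≤ (0 : ℤ), x.coeff j = 0 := by
    rw [← absK_lt_succ_iff]; simpa using hx
  refine ⟨PowerSeries.mk fun k => x.coeff k, ?_, ?_⟩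
  · ext m
    rcases lt_or_ge m 0 with hm | hm
    · rw [h0 m hm.le, HahnSeries.ofPowerSeries_apply]
      rw [HahnSeries.embDomain_of_notMem_range]
      rintro ⟨k, rfl⟩
      simp at hm
      omega
    · lift m to ℕ using hm
      rw [HahnSeries.ofPowerSeries_apply_coeff, PowerSeries.coeff_mk]
  · rw [Ideal.mem_span_singleton, PowerSeries.X_dvd_iff, ← PowerSeries.coeff_zero_eq_constantCoeff_apply,
      PowerSeries.coeff_mk]
    exact h0 0 le_rfl

lemma absK_ofPowerSeries_le (c : PowerSeries Fq) :
    absK Fq (HahnSeries.ofPowerSeries ℤ Fq c) ≤ 1 := by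
  have := (absK_le_iff Fq (HahnSeries.ofPowerSeries ℤ Fq c) 0).mpr (by
    intro j hj
    rw [HahnSeries.ofPowerSeries_apply, HahnSeries.embDomain_of_notMem_range]
    rintro ⟨k, rfl⟩
    simp at hj
    omega)
  simpa using this

lemma absK_one : absK Fq 1 = 1 := map_one (vK Fq)

lemma absK_ofPowerSeries_lt {c : PowerSeries Fq}
    (hc : c ∈ Ideal.span {(PowerSeries.X : PowerSeries Fq)}) :
    absK Fq (HahnSeries.ofPowerSeries ℤ Fq c) < 1 := by
  rw [Ideal.mem_span_singleton] at hc
  obtain ⟨d, rfl⟩ := hc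
  rw [map_mul, absK_mul, HahnSeries.ofPowerSeries_X]
  have h1 : absK Fq (HahnSeries.single (1 : ℤ) (1 : Fq)) < 1 := by
    have := (absK_lt_succ_iff Fq (HahnSeries.single (1 : ℤ) (1 : Fq)) 0).mpr (by
      intro j hj
      rw [HahnSeries.coeff_single_of_ne]; omega)
    simpa using this
  calc _ ≤ absK Fq (HahnSeries.single (1 : ℤ) (1 : Fq)) * 1 :=
        mul_le_mul_of_nonneg_left (absK_ofPowerSeries_le Fq d) (absK_nonneg Fq _)
    _ < 1 := by rw [mul_one]; exact h1

lemma hensel_aux (m : ℕ) (g : ℕ → K Fq) (hg : ∀ j, absK Fq (g j) < 1) :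
    ∃ y : K Fq, absK Fq y = 1 ∧ 1 - y + ∑ j ∈ Finset.range (m + 1), g j * y ^ (j + 2) = 0 := by
  choose c hc hcI using fun j => exists_powerSeries Fq (hg j)
  set I := Ideal.span {(PowerSeries.X : PowerSeries Fq)} with hI
  let r : (PowerSeries Fq)[X] := - X ^ (m + 1) +
    ∑ j ∈ Finset.range (m + 1), Polynomial.C (c j) * X ^ (m - j)
  let f : (PowerSeries Fq)[X] := X ^ (m + 2) + r
  have hr : r.degree < ((m + 2 : ℕ) : WithBot ℕ) := by
    refine lt_of_le_of_lt (b := ((m + 1 : ℕ) : WithBot ℕ)) ?_ (by exact_mod_cast Nat.lt_succ_self _)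
    refine (degree_add_le _ _).trans (max_le ?_ ?_)
    · rw [degree_neg]; exact degree_X_pow_le _
    · refine (degree_sum_le _ _).trans (Finset.sup_le fun j _ => ?_)
      refine (degree_C_mul_X_pow_le _ _).trans ?_
      exact_mod_cast (by omega : m - j ≤ m + 1)
  have hmonic : f.Monic := monic_X_pow_add hr
  have he : f.eval 1 ∈ I := by
    have : f.eval 1 = ∑ j ∈ Finset.range (m + 1), c j := by
      simp [f, r, eval_finsetSum]
    rw [this]
    exact Ideal.sum_mem _ fun j _ => hcI j
  have hd : f.derivative.eval 1 - 1 ∈ I := by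
    have : f.derivative.eval 1 - 1 = ∑ j ∈ Finset.range (m + 1), c j * ((m - j : ℕ) : PowerSeries Fq) := by
      simp [f, r, eval_finsetSum, derivative_sum, derivative_X_pow]
      ring
    rw [this]
    exact Ideal.sum_mem _ fun j _ => Ideal.mul_mem_right _ _ (hcI j)
  have hu : IsUnit (Ideal.Quotient.mk I (f.derivative.eval 1)) := by
    rw [Ideal.Quotient.eq.mpr hd, map_one]
    exact isUnit_one
  obtain ⟨a, ha, haI⟩ := HenselianRing.is_henselian (I := I) f hmonic 1 he hu
  set A : K Fq := HahnSeries.ofPowerSeries ℤ Fq a with hA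
  have hA1 : absK Fq (A - 1) < 1 := by
    have := absK_ofPowerSeries_lt Fq haI
    rwa [map_sub, map_one] at this
  have hAabs : absK Fq A = 1 := by
    have := (vK_na Fq).add_eq_right_of_lt (x := A - 1) (y := 1)
      (by rw [vK_apply, vK_apply, absK_one]; exact hA1)
    rw [sub_add_cancel, vK_apply, vK_apply, absK_one] at this
    exact this
  have hA0 : A ≠ 0 := by
    intro h; rw [h, absK_zero] at hAabs; norm_num at hAabs
  have hroot : A ^ (m + 2) - A ^ (m + 1) + ∑ j ∈ Finset.range (m + 1), g j * A ^ (m - j) = 0 := by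
    have h2 : f.eval a = 0 := ha
    have h1 := congrArg (HahnSeries.ofPowerSeries ℤ Fq) h2
    simp only [f, r, eval_add, eval_pow, eval_X, eval_neg, eval_finsetSum, eval_mul, eval_C,
      map_add, map_neg, map_pow, map_sum, map_mul, map_zero, hc] at h1
    rw [← h1]; ring
  refine ⟨A⁻¹, ?_, ?_⟩
  · rw [← vK_apply, map_inv₀, vK_apply, hAabs, inv_one]
  · have h3 : A ^ (m + 2) * (1 - A⁻¹ + ∑ j ∈ Finset.range (m + 1), g j * A⁻¹ ^ (j + 2)) = 0 := by
      rw [← hroot, mul_add, mul_sub, mul_one, Finset.mul_sum]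
      congr 1
      · congr 1
        rw [pow_succ A (m + 1), mul_assoc, mul_inv_cancel₀ hA0, mul_one]
      · refine Finset.sum_congr rfl fun j hj => ?_
        have hj' : j ≤ m := by simpa [Nat.lt_succ_iff] using hj
        have : A ^ (m + 2) = A ^ (m - j) * A ^ (j + 2) := by
          rw [← pow_add]; congr 1; omega
        rw [this, inv_pow]
        have : A ^ (j + 2) ≠ 0 := pow_ne_zero _ hA0
        field_simp
    exact (mul_eq_zero.mp h3).resolve_left (pow_ne_zero _ hA0)

/-- Hensel's lemma in the form needed: `G` has a unique small root. -/
lemma hensel (G : (K Fq)[X]) (ρ : ℝ) (hρ : 0 ≤ ρ)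
    (h01 : absK Fq (G.coeff 0) ≤ absK Fq (G.coeff 1) * ρ)
    (hk : ∀ k ≥ 2, absK Fq (G.coeff k) * ρ ^ (k - 1) < absK Fq (G.coeff 1)) :
    ∃ δ : K Fq, absK Fq δ ≤ ρ ∧ G.eval δ = 0 := by
  by_cases h0 : G.coeff 0 = 0
  · exact ⟨0, by rwa [absK_zero], by rw [← coeff_zero_eq_eval_zero, h0]⟩
  have h1 : G.coeff 1 ≠ 0 := by
    intro h
    rw [h, absK_zero, zero_mul] at h01
    exact absurd h01 (not_le.mpr (absK_pos Fq h0))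
  set h : K Fq := -(G.coeff 0) / G.coeff 1 with hh
  have habs : absK Fq h = absK Fq (G.coeff 0) / absK Fq (G.coeff 1) := by
    rw [← vK_apply, hh, map_div₀, AbsoluteValue.map_neg]; rfl
  have hhρ : absK Fq h ≤ ρ := by
    rw [habs, div_le_iff₀ (absK_pos Fq h1)]; linarith
  have hG1 : G.coeff 1 * h = - G.coeff 0 := by rw [hh]; field_simp
  have hg : ∀ j, absK Fq (G.coeff (j + 2) * h ^ (j + 2) / G.coeff 0) < 1 := by
    intro j
    have e : G.coeff (j + 2) * h ^ (j + 2) / G.coeff 0 = - (G.coeff (j + 2) * h ^ (j + 1) / G.coeff 1) := by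
      have : G.coeff 0 = - (G.coeff 1 * h) := by rw [hG1, neg_neg]
      have hne : h ≠ 0 := by
        intro h00; rw [h00, mul_zero, neg_zero] at this; exact h0 this
      rw [this]
      field_simp
      ring
    rw [e, ← vK_apply, AbsoluteValue.map_neg, map_div₀, map_mul, map_pow, vK_apply, vK_apply, vK_apply,
      div_lt_one (absK_pos Fq h1)]
    have := hk (j + 2) (by omega)
    refine lt_of_le_of_lt ?_ this
    exact mul_le_mul_of_nonneg_left (pow_le_pow_left₀ (absK_nonneg Fq h) hhρ _) (absK_nonneg Fq _)
  obtain ⟨y, hy1, hy⟩ := hensel_aux Fq G.natDegree _ hg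
  refine ⟨h * y, by rwa [absK_mul, hy1, mul_one], ?_⟩
  rw [eval_eq_sum_range' (n := G.natDegree + 1 + 2) (by omega), Finset.sum_range_succ',
    Finset.sum_range_succ']
  have h4 := congrArg (G.coeff 0 * ·) hy
  simp only [mul_add, mul_sub, Finset.mul_sum, mul_zero] at h4
  rw [← h4]
  have : ∀ j, G.coeff 0 * (G.coeff (j + 2) * h ^ (j + 2) / G.coeff 0 * y ^ (j + 2)) =
      G.coeff (j + 2) * (h * y) ^ (j + 2) := by
    intro j; rw [mul_pow]; field_simp
  simp only [this, zero_add, pow_one, pow_zero]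
  rw [← mul_assoc (G.coeff 1), hG1]
  ring


/-! ### Polynomials over a valued field: domination, isolation, resultant bound -/

section generic

variable {L : Type} [Field L] (v : AbsoluteValue L ℝ) (hv : IsNonarchimedean v)

/-- The constant coefficient strictly dominates on the disc of radius `ρ`. -/
def Dom (F : L[X]) (ρ : ℝ) : Prop := ∀ k ≥ 1, v (F.coeff k) * ρ ^ k < v (F.coeff 0)

/-- `F` has exactly one root in the disc of radius `ρ`. -/
def Iso (F : L[X]) (ρ : ℝ) : Prop :=
  v (F.coeff 0) ≤ v (F.coeff 1) * ρ ∧ ∀ k ≥ 2, v (F.coeff k) * ρ ^ (k - 1) < v (F.coeff 1)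

variable {v}

lemma Dom.pos {F : L[X]} {ρ : ℝ} (h : Dom v F ρ) : 0 < v (F.coeff 0) := by
  have := h (F.natDegree + 1) (by omega)
  rwa [coeff_eq_zero_of_natDegree_lt (by omega), map_zero, zero_mul] at this

lemma Dom.le {F : L[X]} {ρ : ℝ} (h : Dom v F ρ) (k : ℕ) :
    v (F.coeff k) * ρ ^ k ≤ v (F.coeff 0) := by
  rcases Nat.eq_zero_or_pos k with rfl | hk
  · simp
  · exact (h k hk).le

lemma coeff_le_gauss (R : L[X]) (i : ℕ) : v (R.coeff i) ≤ R.gaussNorm v 1 := by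
  simpa using le_gaussNorm v (p := R) (c := 1) zero_le_one i

lemma gauss_nonneg (R : L[X]) : 0 ≤ R.gaussNorm v 1 :=
  (v.nonneg _).trans (coeff_le_gauss R 0)

include hv

lemma na_sum_lt {ι : Type*} (s : Finset ι) (f : ι → L) {B : ℝ} (hB : 0 < B)
    (h : ∀ i ∈ s, v (f i) < B) : v (∑ i ∈ s, f i) < B := by
  induction s using Finset.induction_on with
  | empty => simpa using hB
  | insert a s ha ih =>
    rw [Finset.sum_insert ha]
    refine (hv _ _).trans_lt (max_lt (h a (by simp)) (ih fun i hi => h i (by simp [hi])))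

lemma na_sum_le {ι : Type*} (s : Finset ι) (f : ι → L) {B : ℝ} (hB : 0 ≤ B)
    (h : ∀ i ∈ s, v (f i) ≤ B) : v (∑ i ∈ s, f i) ≤ B := by
  induction s using Finset.induction_on with
  | empty => simpa using hB
  | insert a s ha ih =>
    rw [Finset.sum_insert ha]
    refine (hv _ _).trans (max_le (h a (by simp)) (ih fun i hi => h i (by simp [hi])))

lemma Dom.mul {A B : L[X]} {ρ : ℝ} (hρ : 0 < ρ) (hA : Dom v A ρ) (hB : Dom v B ρ) :
    Dom v (A * B) ρ := by
  intro k hk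
  have hpos := mul_pos hA.pos hB.pos
  rw [mul_coeff_zero, map_mul, ← lt_div_iff₀ (by positivity), coeff_mul]
  refine na_sum_lt hv _ _ (by positivity) ?_
  rintro ⟨i, j⟩ hij
  rw [Finset.HasAntidiagonal.mem_antidiagonal] at hij
  subst hij
  simp only at hk ⊢
  rw [lt_div_iff₀ (by positivity), map_mul, pow_add]
  have e : v (A.coeff i) * v (B.coeff j) * (ρ ^ i * ρ ^ j) =
    (v (A.coeff i) * ρ ^ i) * (v (B.coeff j) * ρ ^ j) := by ring
  rw [e]
  have hAn : 0 ≤ v (A.coeff i) * ρ ^ i := mul_nonneg (v.nonneg _) (by positivity)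
  have hBn : 0 ≤ v (B.coeff j) * ρ ^ j := mul_nonneg (v.nonneg _) (by positivity)
  rcases Nat.eq_zero_or_pos i with rfl | hi
  · exact mul_lt_mul_of_le_of_lt_of_nonneg_of_pos (hA.le 0) (hB j (by omega)) hBn hA.pos
  · exact mul_lt_mul_of_lt_of_le_of_nonneg_of_pos (hA i hi) (hB.le j) hAn hB.pos

omit hv in
lemma dom_C {c : L} (hc : c ≠ 0) (ρ : ℝ) : Dom v (C c) ρ := by
  intro k hk
  rw [coeff_C_of_ne_zero (by omega), coeff_C_zero, map_zero, zero_mul]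
  exact v.pos hc

omit hv in
lemma dom_X_sub_C {δ : L} {ρ : ℝ} (hρ : 0 < ρ) (h : ρ < v δ) : Dom v (X - C δ) ρ := by
  intro k hk
  have h0 : (X - C δ : L[X]).coeff 0 = -δ := by simp
  rw [h0, AbsoluteValue.map_neg]
  rcases Nat.lt_or_ge 1 k with h1 | h1
  · rw [coeff_sub, coeff_X_of_ne_one (by omega), coeff_C_of_ne_zero (by omega), sub_zero, map_zero,
      zero_mul]
    exact hρ.trans h
  · have : k = 1 := by omega
    subst this
    simpa using h

lemma Dom.eval_le {F : L[X]} {ρ : ℝ} (hF : Dom v F ρ) {x : L} (hx : v x ≤ ρ) :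
    v (F.eval x) ≤ v (F.coeff 0) := by
  rw [eval_eq_sum_range]
  refine na_sum_le hv _ _ (v.nonneg _) fun i _ => ?_
  rw [map_mul, map_pow]
  refine le_trans ?_ (hF.le i)
  exact mul_le_mul_of_nonneg_left (pow_le_pow_left₀ (v.nonneg _) hx _) (v.nonneg _)

lemma dom_prod {c : L} (hc : c ≠ 0) {ρ : ℝ} (hρ : 0 < ρ) (S : Multiset L) (hS : ∀ δ ∈ S, ρ < v δ) :
    Dom v (C c * (S.map fun δ => X - C δ).prod) ρ := by
  induction S using Multiset.induction_on with
  | empty => simpa using dom_C hc ρ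
  | cons a S ih =>
    rw [Multiset.map_cons, Multiset.prod_cons, mul_left_comm]
    exact Dom.mul hv hρ (dom_X_sub_C hρ (hS a (by simp))) (ih fun δ hδ => hS δ (by simp [hδ]))

lemma iso_of_dom {δ : L} {ρ : ℝ} (hρ : 0 < ρ) (hδ : v δ ≤ ρ) {G : L[X]} (hG : Dom v G ρ) :
    Iso v ((X - C δ) * G) ρ := by
  have hc : ∀ k, ((X - C δ) * G).coeff (k + 1) = G.coeff k + -(δ * G.coeff (k + 1)) := by
    intro k; rw [sub_mul, coeff_sub, coeff_X_mul, coeff_C_mul, sub_eq_add_neg]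
  have h0 : ((X - C δ) * G).coeff 0 = -δ * G.coeff 0 := by simp
  have hlt : ∀ k, v (δ * G.coeff (k + 1)) * ρ ^ k < v (G.coeff 0) := by
    intro k
    refine lt_of_le_of_lt ?_ (hG (k + 1) (by omega))
    rw [map_mul, pow_succ]
    have : 0 ≤ v (G.coeff (k + 1)) * ρ ^ k := mul_nonneg (v.nonneg _) (by positivity)
    nlinarith
  have h1 : v (((X - C δ) * G).coeff 1) = v (G.coeff 0) := by
    rw [hc 0]
    apply hv.add_eq_left_of_lt
    rw [AbsoluteValue.map_neg]
    simpa using hlt 0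
  refine ⟨?_, ?_⟩
  · rw [h0, h1, map_mul, AbsoluteValue.map_neg, mul_comm]
    exact mul_le_mul_of_nonneg_left hδ (v.nonneg _)
  · intro k hk
    obtain ⟨j, rfl⟩ : ∃ j, k = j + 1 := ⟨k - 1, by omega⟩
    rw [h1, hc, Nat.add_sub_cancel, ← lt_div_iff₀ (by positivity)]
    refine (hv _ _).trans_lt (max_lt ?_ ?_)
    · rw [lt_div_iff₀ (by positivity)]; exact hG j (by omega)
    · rw [lt_div_iff₀ (by positivity), AbsoluteValue.map_neg]; exact hlt j

omit hv in
lemma taylor_prod (x c : L) (S : Multiset L) :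
    taylor x (C c * (S.map fun δ => X - C δ).prod) =
      C c * ((S.map fun δ => δ - x).map fun δ => X - C δ).prod := by
  induction S using Multiset.induction_on with
  | empty => simp
  | cons a S ih =>
    simp only [Multiset.map_cons, Multiset.prod_cons]
    rw [mul_left_comm, taylor_mul, ih, mul_left_comm (C c)]
    congr 1
    simp
    ring

lemma trichotomy {F : L[X]} (hF0 : F ≠ 0) (hF : F.Splits) (x : L) {ρ : ℝ} (hρ : 0 < ρ) :
    Dom v (taylor x F) ρ ∨ Iso v (taylor x F) ρ ∨
      ∃ a b S, F.roots = a ::ₘ b ::ₘ S ∧ v (a - x) ≤ ρ ∧ v (b - x) ≤ ρ := by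
  have hlc : F.leadingCoeff ≠ 0 := leadingCoeff_ne_zero.mpr hF0
  by_cases h1 : ∀ a ∈ F.roots, ρ < v (a - x)
  · left
    rw [hF.eq_prod_roots, taylor_prod]
    apply dom_prod hv hlc hρ
    intro δ hδ
    obtain ⟨a, ha, rfl⟩ := Multiset.mem_map.mp hδ
    exact h1 a ha
  right
  push Not at h1
  obtain ⟨a, ha, hax⟩ := h1
  obtain ⟨S, hS⟩ := Multiset.exists_cons_of_mem ha
  by_cases h2 : ∀ b ∈ S, ρ < v (b - x)
  · left
    rw [hF.eq_prod_roots, taylor_prod, hS, Multiset.map_cons, Multiset.map_cons,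
      Multiset.prod_cons, mul_left_comm]
    apply iso_of_dom hv hρ hax
    apply dom_prod hv hlc hρ
    intro δ hδ
    obtain ⟨a, ha, rfl⟩ := Multiset.mem_map.mp hδ
    exact h2 a ha
  · right
    push Not at h2
    obtain ⟨b, hb, hbx⟩ := h2
    obtain ⟨S', rfl⟩ := Multiset.exists_cons_of_mem hb
    exact ⟨a, b, S', hS, hax, hbx⟩

lemma eval_le_gauss {R : L[X]} {e : ℕ} (he : R.natDegree ≤ e) (x : L) :
    v (R.eval x) ≤ R.gaussNorm v 1 * max 1 (v x) ^ e := by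
  have hm : (1 : ℝ) ≤ max 1 (v x) := le_max_left _ _
  have hg : ∀ i, v (R.coeff i) ≤ R.gaussNorm v 1 := fun i => by
    simpa using le_gaussNorm v (p := R) (c := 1) zero_le_one i
  have hg0 : 0 ≤ R.gaussNorm v 1 := (v.nonneg _).trans (hg 0)
  rw [eval_eq_sum_range]
  refine na_sum_le hv _ _ (by positivity) fun i hi => ?_
  have hi : i ≤ e := by
    have := Finset.mem_range.mp hi; omega
  rw [map_mul, map_pow]
  refine mul_le_mul (hg i) ?_ (by positivity) hg0
  exact (pow_le_pow_left₀ (v.nonneg _) (le_max_right _ _) i).trans (pow_le_pow_right₀ hm hi)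

lemma mahler_le (c : L) (S : Multiset L) :
    v c * (S.map fun a => max 1 (v a)).prod ≤
      (C c * (S.map fun δ => X - C δ).prod).gaussNorm v 1 := by
  induction S using Multiset.induction_on with
  | empty =>
    simp
  | cons a S ih =>
    simp only [Multiset.map_cons, Multiset.prod_cons]
    rw [mul_left_comm (C c), gaussNorm_mul hv one_pos, mul_left_comm (v c)]
    refine mul_le_mul (max_le ?_ ?_) ih (mul_nonneg (v.nonneg _) ?_) ?_
    · have e : (X - C a : L[X]).coeff 1 = 1 := by rw [coeff_sub, coeff_X_one]; simp
      have := coeff_le_gauss (v := v) (X - C a) 1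
      rwa [e, map_one] at this
    · have e : (X - C a : L[X]).coeff 0 = -a := by simp
      have := coeff_le_gauss (v := v) (X - C a) 0
      rwa [e, AbsoluteValue.map_neg] at this
    · exact Multiset.prod_nonneg (by
        intro y hy
        obtain ⟨b, _, rfl⟩ := Multiset.mem_map.mp hy
        positivity)
    · exact gauss_nonneg _

lemma prod_eval_le {R : L[X]} {e : ℕ} (he : R.natDegree ≤ e) (S : Multiset L) :
    v ((S.map R.eval).prod) ≤
      R.gaussNorm v 1 ^ (Multiset.card S) * ((S.map fun a => max 1 (v a)).prod) ^ e := by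
  induction S using Multiset.induction_on with
  | empty => simp
  | cons a S ih =>
    simp only [Multiset.map_cons, Multiset.prod_cons, Multiset.card_cons, map_mul]
    have h1 := eval_le_gauss hv he a
    calc _ ≤ _ := mul_le_mul h1 ih (v.nonneg _) ((v.nonneg _).trans h1)
      _ = _ := by rw [pow_succ, mul_pow]; ring

omit hv in
lemma one_le_prod_max (S : Multiset L) : 1 ≤ (S.map fun a => max 1 (v a)).prod := by
  induction S using Multiset.induction_on with
  | empty => simp
  | cons a S ih =>
    simp only [Multiset.map_cons, Multiset.prod_cons]
    exact one_le_mul_of_one_le_of_one_le (le_max_left _ _) ih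

lemma res_bound {F R : L[X]} (hF : F.Splits) {e : ℕ} (he : R.natDegree ≤ e)
    {A S : Multiset L} (hAS : F.roots = A + S) :
    v (resultant F R F.natDegree e) ≤
      v ((A.map R.eval).prod) * R.gaussNorm v 1 ^ (Multiset.card S) * F.gaussNorm v 1 ^ e := by
  have hg0 : 0 ≤ R.gaussNorm v 1 := gauss_nonneg R
  rw [resultant_eq_prod_eval _ _ _ he hF, hAS, Multiset.map_add, Multiset.prod_add, map_mul,
    map_mul, map_pow]
  have h1 := prod_eval_le hv he S
  have h2 := mahler_le hv F.leadingCoeff F.roots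
  rw [← hF.eq_prod_roots, hAS, Multiset.map_add, Multiset.prod_add] at h2
  have hA := one_le_prod_max (v := v) A
  have hS := one_le_prod_max (v := v) S
  have h3 : v F.leadingCoeff * (S.map fun a => max 1 (v a)).prod ≤ F.gaussNorm v 1 := by
    refine le_trans ?_ h2
    refine mul_le_mul_of_nonneg_left ?_ (v.nonneg _)
    nlinarith
  calc _ ≤ v F.leadingCoeff ^ e * (v ((A.map R.eval).prod) *
        (R.gaussNorm v 1 ^ (Multiset.card S) * ((S.map fun a => max 1 (v a)).prod) ^ e)) := by
        gcongr
    _ = v ((A.map R.eval).prod) * R.gaussNorm v 1 ^ (Multiset.card S) *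
        (v F.leadingCoeff * (S.map fun a => max 1 (v a)).prod) ^ e := by rw [mul_pow]; ring
    _ ≤ _ := by
        gcongr

end generic


/-! ### Frobenius decomposition -/

section frob

variable (p : ℕ) [Fact p.Prime] [CharP Fq p]

instance : CharP (K Fq) p :=
  charP_of_injective_ringHom (f := emb Fq) (emb_injective Fq) p

/-- the `i`-th component in the decomposition `A = ∑ X^i c_i^p`. -/
def cut (i : ℕ) (A : Fq[X]) : Fq[X] :=
  ∑ j ∈ Finset.range (A.natDegree + 1), monomial j ((frobeniusEquiv Fq p).symm (A.coeff (p * j + i)))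

lemma coeff_cut (i : ℕ) (A : Fq[X]) (j : ℕ) :
    (cut Fq p i A).coeff j = (frobeniusEquiv Fq p).symm (A.coeff (p * j + i)) := by
  have hp : 1 ≤ p := (Fact.out : p.Prime).one_le
  rw [cut, finsetSum_coeff]
  simp only [coeff_monomial]
  rw [Finset.sum_ite_eq']
  split_ifs with h
  · rfl
  · rw [Finset.mem_range] at h
    rw [coeff_eq_zero_of_natDegree_lt, map_zero]
    nlinarith

lemma cut_zero (i : ℕ) : cut Fq p i 0 = 0 := by
  ext j; rw [coeff_cut]; simp

lemma natDegree_cut (i : ℕ) (A : Fq[X]) : p * (cut Fq p i A).natDegree ≤ A.natDegree := by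
  by_cases h : cut Fq p i A = 0
  · rw [h]; simp
  have h1 : (cut Fq p i A).coeff (cut Fq p i A).natDegree ≠ 0 := by
    simpa using h
  rw [coeff_cut] at h1
  have h2 : A.coeff (p * (cut Fq p i A).natDegree + i) ≠ 0 := by
    intro h; rw [h, map_zero] at h1; exact h1 rfl
  have := le_natDegree_of_ne_zero h2
  omega

lemma sum_cut (A : Fq[X]) : A = ∑ i ∈ Finset.range p, X ^ i * cut Fq p i A ^ p := by
  have hp : 0 < p := (Fact.out : p.Prime).pos
  ext N
  rw [finsetSum_coeff, Finset.sum_eq_single (N % p)]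
  · rw [coeff_X_pow_mul', if_pos (Nat.mod_le _ _), ← map_frobenius_expand, coeff_map,
      coeff_expand hp, if_pos (Nat.dvd_sub_mod N), coeff_cut, frobenius_apply_frobeniusEquiv_symm]
    congr 1
    rw [Nat.mul_div_cancel' (Nat.dvd_sub_mod N), Nat.sub_add_cancel (Nat.mod_le _ _)]
  · intro i hi hne
    rw [coeff_X_pow_mul']
    split_ifs with h
    · rw [← map_frobenius_expand, coeff_map, coeff_expand hp, if_neg, map_zero]
      intro hd
      apply hne
      have h1 := (Nat.modEq_iff_dvd' h).mpr hd
      rw [← Nat.mod_eq_of_lt (Finset.mem_range.mp hi)]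
      exact h1
    · rfl
  · intro h
    exact absurd (Finset.mem_range.mpr (Nat.mod_lt N hp)) h

/-- Coefficientwise `cut`. -/
def cutP (i : ℕ) (P : Fq[X][X]) : Fq[X][X] :=
  ∑ k ∈ Finset.range (P.natDegree + 1), monomial k (cut Fq p i (P.coeff k))

lemma coeff_cutP (i : ℕ) (P : Fq[X][X]) (k : ℕ) :
    (cutP Fq p i P).coeff k = cut Fq p i (P.coeff k) := by
  rw [cutP, finsetSum_coeff]
  simp only [coeff_monomial]
  rw [Finset.sum_ite_eq']
  split_ifs with h
  · rfl
  · rw [Finset.mem_range] at h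
    rw [coeff_eq_zero_of_natDegree_lt (by omega), cut_zero]

lemma natDegree_cutP (i : ℕ) (P : Fq[X][X]) : (cutP Fq p i P).natDegree ≤ P.natDegree := by
  rw [natDegree_le_iff_coeff_eq_zero]
  intro N hN
  rw [coeff_cutP, coeff_eq_zero_of_natDegree_lt hN, cut_zero]

lemma ht_cutP (i : ℕ) (P : Fq[X][X]) : p * ht Fq (cutP Fq p i P) ≤ ht Fq P := by
  by_cases h : cutP Fq p i P = 0
  · rw [h]; simp [ht]
  obtain ⟨k, hk, hk'⟩ := Finset.exists_mem_eq_sup _ (support_nonempty.mpr h)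
      (fun k => ((cutP Fq p i P).coeff k).natDegree)
  rw [ht, hk', coeff_cutP]
  exact (natDegree_cut Fq p i _).trans (natDegree_coeff_le_ht Fq P k)

lemma emb_X : emb Fq X = Tvar Fq := by rw [emb, coe_eval₂RingHom, eval₂_X]

lemma sum_cutP (P : Fq[X][X]) :
    P.map (emb Fq) = ∑ i ∈ Finset.range p,
      C (Tvar Fq ^ i) * ((cutP Fq p i P).map (emb Fq)).map (frobenius (K Fq) p) := by
  ext1 k
  rw [finsetSum_coeff, coeff_map]
  conv_lhs => rw [sum_cut Fq p (P.coeff k)]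
  rw [map_sum]
  refine Finset.sum_congr rfl fun i _ => ?_
  rw [coeff_C_mul, coeff_map, coeff_map, coeff_cutP, frobenius_def, map_mul, map_pow, map_pow, emb_X]

end frob

/-- The Taylor expansion at `ξ`. -/
def Tay (ξ : K Fq) (P : Fq[X][X]) : (K Fq)[X] := taylor ξ (P.map (emb Fq))

lemma Tay_coeff_zero (ξ : K Fq) (P : Fq[X][X]) : (Tay Fq ξ P).coeff 0 = evalK Fq P ξ := by
  rw [Tay, taylor_coeff_zero, eval_map, evalK]

lemma Tay_mul (ξ : K Fq) (P Q : Fq[X][X]) : Tay Fq ξ (P * Q) = Tay Fq ξ P * Tay Fq ξ Q := by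
  rw [Tay, Polynomial.map_mul, taylor_mul]; rfl

lemma evalK_mul (ξ : K Fq) (P Q : Fq[X][X]) : evalK Fq (P * Q) ξ = evalK Fq P ξ * evalK Fq Q ξ :=
  eval₂_mul _ _

lemma Tay_eval (ξ x : K Fq) (P : Fq[X][X]) : (Tay Fq ξ P).eval x = evalK Fq P (x + ξ) := by
  rw [Tay, taylor_eval, eval_map, evalK]

section frob

variable (p : ℕ) [Fact p.Prime] [CharP Fq p]

lemma Tay_frob (ξ : K Fq) (P : Fq[X][X]) (k : ℕ) :
    (Tay Fq (ξ ^ p) P).coeff k = ∑ i ∈ Finset.range p,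
      Tvar Fq ^ i * ((Tay Fq ξ (cutP Fq p i P)).coeff k) ^ p := by
  rw [Tay, sum_cutP Fq p P, map_sum, finsetSum_coeff]
  refine Finset.sum_congr rfl fun i _ => ?_
  rw [taylor_mul, taylor_C, coeff_C_mul, ← frobenius_def p ξ, ← map_taylor, coeff_map, frobenius_def]
  rfl

lemma absK_pow (x : K Fq) (k : ℕ) : absK Fq (x ^ k) = absK Fq x ^ k := map_pow (vK Fq) x k

/-- Terms of `∑ T^i y_i^p` have distinct absolute values. -/
lemma absK_sum_frob_le (y : ℕ → K Fq) {i : ℕ} (hi : i < p) :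
    absK Fq (Tvar Fq ^ i * y i ^ p) ≤
      absK Fq (∑ i ∈ Finset.range p, Tvar Fq ^ i * y i ^ p) := by
  have hq := one_lt_q Fq
  have hp : 0 < p := (Fact.out : p.Prime).pos
  obtain ⟨k, hk, hmax⟩ := Finset.exists_max_image (Finset.range p)
    (fun i => absK Fq (Tvar Fq ^ i * y i ^ p)) ⟨0, Finset.mem_range.mpr hp⟩
  by_cases hk0 : y k = 0
  · have := hmax i (Finset.mem_range.mpr hi)
    simp only [hk0, zero_pow hp.ne', mul_zero, absK_zero] at this
    exact this.trans (absK_nonneg Fq _)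
  have key := (vK_na Fq).apply_sum_eq_of_lt (fun a => ((vK Fq).map_neg a).symm) (s := Finset.range p)
    (l := fun i => Tvar Fq ^ i * y i ^ p) (k := k) hk (by
      intro j hj hjk
      refine lt_of_le_of_ne (hmax j hj) ?_
      intro heq
      simp only [vK_apply, absK_mul, absK_pow, absK_Tvar] at heq
      by_cases hj0 : y j = 0
      · rw [hj0, absK_zero, zero_pow hp.ne', mul_zero] at heq
        have := absK_pos Fq hk0
        have : 0 < (Fintype.card Fq : ℝ) ^ k * absK Fq (y k) ^ p := by positivity
        linarith
      · rw [absK_of_ne Fq hj0, absK_of_ne Fq hk0, ← zpow_natCast, ← zpow_natCast, ← zpow_natCast,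
          ← zpow_natCast, ← zpow_mul, ← zpow_mul, ← zpow_add₀ (by positivity),
          ← zpow_add₀ (by positivity)] at heq
        have h2 := zpow_right_injective₀ (by positivity) hq.ne' heq
        have h3 : ((j : ℤ)) % p = (k : ℤ) % p := by
          apply Int.emod_emod_of_dvd _ _ |>.symm.trans _ <;> try exact dvd_refl _
          have : (j : ℤ) = k + p * (- (y k).order + (y j).order) := by linarith
          rw [this]; simp
        have h4 : j % p = k % p := by exact_mod_cast h3
        rw [Nat.mod_eq_of_lt (Finset.mem_range.mp hj), Nat.mod_eq_of_lt (Finset.mem_range.mp hk)] at h4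
        exact hjk h4)
  simp only [vK_apply] at key
  rw [key]
  exact hmax i (Finset.mem_range.mpr hi)

lemma evalK_cutP_of_root {α : K Fq} {P : Fq[X][X]} (h : evalK Fq P (α ^ p) = 0) {i : ℕ} (hi : i < p) :
    evalK Fq (cutP Fq p i P) α = 0 := by
  rw [← Tay_coeff_zero, Tay_frob] at h
  have h1 := absK_sum_frob_le Fq p (fun i => (Tay Fq α (cutP Fq p i P)).coeff 0) hi
  rw [h, absK_zero] at h1
  by_contra h2
  rw [← Tay_coeff_zero] at h2
  have hT : Tvar Fq ≠ 0 := by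
    intro h; have := absK_Tvar Fq; rw [h, absK_zero] at this
    have := one_lt_q Fq; linarith
  exact absurd h1 (not_le.mpr (absK_pos Fq (mul_ne_zero (pow_ne_zero _ hT) (pow_ne_zero _ h2))))

lemma exists_cutP_ne_zero {P : Fq[X][X]} (hP : P ≠ 0) : ∃ i < p, cutP Fq p i P ≠ 0 := by
  by_contra h
  push Not at h
  apply hP
  apply Polynomial.map_injective (emb Fq) (emb_injective Fq)
  rw [sum_cutP Fq p P, Polynomial.map_zero]
  exact Finset.sum_eq_zero fun i hi => by rw [h i (Finset.mem_range.mp hi)]; simp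

/-- Frobenius twist of the coefficients. -/
def tw (P : Fq[X][X]) : Fq[X][X] := P.map (frobenius Fq[X] p)

lemma natDegree_tw (P : Fq[X][X]) : (tw Fq p P).natDegree = P.natDegree :=
  natDegree_map_eq_of_injective (frobenius_inj _ p) P

lemma tw_ne_zero {P : Fq[X][X]} (hP : P ≠ 0) : tw Fq p P ≠ 0 :=
  (Polynomial.map_ne_zero_iff (frobenius_inj _ p)).mpr hP

lemma ht_tw (P : Fq[X][X]) : ht Fq (tw Fq p P) ≤ p * ht Fq P := by
  apply ht_le
  intro i
  rw [tw, coeff_map, frobenius_def, natDegree_pow]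
  exact Nat.mul_le_mul_left _ (natDegree_coeff_le_ht Fq P i)

lemma evalK_tw (P : Fq[X][X]) (x : K Fq) : evalK Fq (tw Fq p P) (x ^ p) = evalK Fq P x ^ p := by
  rw [evalK, evalK, tw, eval₂_map, ← frobenius_def, ← frobenius_def, hom_eval₂]
  congr 1
  refine RingHom.ext fun a => ?_
  simp only [RingHom.comp_apply, frobenius_def, map_pow]

end frob


/-! ### Irreducible factors, minimal polynomials, heights -/

lemma exists_irreducible_factor_with (N : Fq[X][X] → Prop) (hunit : ∀ u, IsUnit u → ¬ N u)
    (hmul : ∀ A B, A ≠ 0 → B ≠ 0 → N (A * B) → N A ∨ N B) (F : Fq[X][X]) (hF : F ≠ 0) (hN : N F) :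
    ∃ G, Irreducible G ∧ G ∣ F ∧ N G := by
  induction F using UniqueFactorizationMonoid.induction_on_prime with
  | h₁ => exact absurd rfl hF
  | h₂ u hu => exact absurd hN (hunit u hu)
  | h₃ a q ha hq ih =>
    rcases hmul q a hq.ne_zero ha hN with h | h
    · exact ⟨q, hq.irreducible, dvd_mul_right _ _, h⟩
    · obtain ⟨G, h1, h2, h3⟩ := ih ha h
      exact ⟨G, h1, h2.mul_left _, h3⟩

lemma coprime_map {G R : Fq[X][X]} (hG : Irreducible G) (hd : G.natDegree ≠ 0) (hR : ¬ G ∣ R) :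
    IsCoprime (G.map (algebraMap Fq[X] (FractionRing Fq[X])))
      (R.map (algebraMap Fq[X] (FractionRing Fq[X]))) := by
  have hp := hG.isPrimitive hd
  have hG' : Irreducible (G.map (algebraMap Fq[X] (FractionRing Fq[X]))) :=
    hp.irreducible_iff_irreducible_map_fraction_map.mp hG
  rw [hG'.coprime_iff_not_dvd]
  exact fun h => hR (hp.dvd_of_fraction_map_dvd_fraction_map h)

lemma resultant_ne_zero_of {G R : Fq[X][X]} (hG : Irreducible G) (hd : G.natDegree ≠ 0)
    (hR : ¬ G ∣ R) : resultant G R ≠ 0 := by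
  have h := resultant_ne_zero _ _ (coprime_map Fq hG hd hR)
  have hinj : Function.Injective (algebraMap Fq[X] (FractionRing Fq[X])) :=
    IsFractionRing.injective _ _
  rw [natDegree_map_eq_of_injective hinj, natDegree_map_eq_of_injective hinj, resultant_map_map] at h
  intro h0
  rw [h0, map_zero] at h
  exact h rfl

lemma natDegree_ne_zero_of_root {G : Fq[X][X]} (hG : G ≠ 0) {α : K Fq} (h : evalK Fq G α = 0) :
    G.natDegree ≠ 0 := by
  intro h0
  rw [eq_C_of_natDegree_eq_zero h0, evalK, eval₂_C] at h
  have h1 : G.coeff 0 = 0 := emb_injective Fq (by rw [h, map_zero])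
  rw [eq_C_of_natDegree_eq_zero h0, h1, C_0] at hG
  exact hG rfl

lemma dvd_of_common_root {G R : Fq[X][X]} (hG : Irreducible G) {α : K Fq}
    (h1 : evalK Fq G α = 0) (h2 : evalK Fq R α = 0) : G ∣ R := by
  by_contra hR
  have hd := natDegree_ne_zero_of_root Fq hG.ne_zero h1
  have hres := resultant_ne_zero_of Fq hG hd hR
  obtain ⟨a, b, -, -, hab⟩ := exists_mul_add_mul_eq_C_resultant G R le_rfl le_rfl (Or.inl hd)
  have h3 := congrArg (fun P => evalK Fq P α) hab
  simp only [evalK, eval₂_add, eval₂_mul, eval₂_C] at h3 h1 h2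
  rw [h1, h2, zero_mul, zero_mul, add_zero] at h3
  exact hres (emb_injective Fq (by rw [← h3, map_zero]))

lemma exists_irreducible_root {F : Fq[X][X]} (hF : F ≠ 0) {α : K Fq} (h : evalK Fq F α = 0) :
    ∃ G, Irreducible G ∧ G ∣ F ∧ evalK Fq G α = 0 := by
  refine exists_irreducible_factor_with Fq (fun P => evalK Fq P α = 0) ?_ ?_ F hF h
  · rintro u hu h0
    have h1 : IsUnit (evalK Fq u α) := hu.map (eval₂RingHom (emb Fq) α)
    rw [h0] at h1
    exact not_isUnit_zero h1
  · intro A B _ _ hAB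
    rw [evalK_mul] at hAB
    exact mul_eq_zero.mp hAB

lemma degA_le {F : Fq[X][X]} (hF : F ≠ 0) {α : K Fq} (h : evalK Fq F α = 0) :
    degA Fq α ≤ F.natDegree := Nat.sInf_le ⟨F, hF, rfl, h⟩

lemma exists_min {α : K Fq} (h : IsAlgK Fq α) :
    ∃ P : Fq[X][X], P ≠ 0 ∧ P.natDegree = degA Fq α ∧ evalK Fq P α = 0 ∧ HA Fq α = HP Fq P := by
  have hq := one_lt_q Fq
  obtain ⟨P0, h0, h00⟩ := h
  have hne : {d | ∃ P : Fq[X][X], P ≠ 0 ∧ P.natDegree = d ∧ evalK Fq P α = 0}.Nonempty :=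
    ⟨_, P0, h0, rfl, h00⟩
  obtain ⟨P1, h1, h1d, h1e⟩ := Nat.sInf_mem hne
  have hne2 : {m | ∃ P : Fq[X][X], P ≠ 0 ∧ P.natDegree = degA Fq α ∧ evalK Fq P α = 0 ∧
      m = ht Fq P}.Nonempty := ⟨_, P1, h1, h1d, h1e, rfl⟩
  obtain ⟨P, hP, hPd, hPe, hPm⟩ := Nat.sInf_mem hne2
  refine ⟨P, hP, hPd, hPe, ?_⟩
  apply IsLeast.csInf_eq
  refine ⟨⟨P, hP, hPd, hPe, rfl⟩, ?_⟩
  rintro x ⟨Q, hQ, hQd, hQe, rfl⟩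
  rw [HP_eq, HP_eq]
  refine pow_le_pow_right₀ hq.le ?_
  rw [← hPm]
  exact Nat.sInf_le ⟨Q, hQ, hQd, hQe, rfl⟩

lemma HP_mono_of_ht {A B : Fq[X][X]} (h : ht Fq A ≤ ht Fq B) : HP Fq A ≤ HP Fq B :=
  pow_le_pow_right₀ (one_lt_q Fq).le h

lemma HA_le {F : Fq[X][X]} (hF : F ≠ 0) {α : K Fq} (h : evalK Fq F α = 0) :
    HA Fq α ≤ HP Fq F := by
  obtain ⟨G, hG, hGF, hGα⟩ := exists_irreducible_root Fq hF h
  obtain ⟨P, hP, hPd, hPe, -⟩ := exists_min Fq ⟨F, hF, h⟩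
  have h1 := natDegree_le_of_dvd (dvd_of_common_root Fq hG hGα hPe) hP
  have h2 := degA_le Fq hG.ne_zero hGα
  refine le_trans ?_ (HP_mono_of_ht Fq (ht_le_of_dvd Fq hF hGF))
  refine csInf_le ⟨0, ?_⟩ ⟨G, hG.ne_zero, by omega, hGα, rfl⟩
  rintro x ⟨Q, _, _, _, rfl⟩
  exact zero_le_one.trans (one_le_HP Fq Q)

lemma one_le_HA {α : K Fq} (h : IsAlgK Fq α) : 1 ≤ HA Fq α := by
  obtain ⟨P, _, _, _, h⟩ := exists_min Fq h
  rw [h]; exact one_le_HP Fq P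

lemma finite_poly (n D : ℕ) : {P : Fq[X][X] | P.natDegree ≤ n ∧ ht Fq P ≤ D}.Finite := by
  apply Set.Finite.of_injOn (f := fun (P : Fq[X][X]) (i : Fin (n + 1)) (j : Fin (D + 1)) =>
    (P.coeff i).coeff j) (t := Set.univ) (fun _ _ => Set.mem_univ _) _ Set.finite_univ
  rintro P ⟨hP1, hP2⟩ Q ⟨hQ1, hQ2⟩ h
  ext i j
  by_cases hi : i < n + 1
  · by_cases hj : j < D + 1
    · exact congrFun (congrFun h ⟨i, hi⟩) ⟨j, hj⟩
    · have h1 := natDegree_coeff_le_ht Fq P i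
      have h2 := natDegree_coeff_le_ht Fq Q i
      rw [coeff_eq_zero_of_natDegree_lt (p := P.coeff i) (by omega),
        coeff_eq_zero_of_natDegree_lt (p := Q.coeff i) (by omega)]
  · rw [coeff_eq_zero_of_natDegree_lt (p := P) (by omega),
      coeff_eq_zero_of_natDegree_lt (p := Q) (by omega)]

lemma finite_roots {P : Fq[X][X]} (hP : P ≠ 0) : {α : K Fq | evalK Fq P α = 0}.Finite := by
  have h0 : P.map (emb Fq) ≠ 0 := (Polynomial.map_ne_zero_iff (emb_injective Fq)).mpr hP
  refine ((P.map (emb Fq)).roots.toFinset.finite_toSet).subset ?_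
  intro α hα
  rw [Finset.mem_coe, Multiset.mem_toFinset, mem_roots h0, IsRoot, eval_map]
  exact hα

lemma northcott (n D : ℕ) :
    {α : K Fq | IsAlgK Fq α ∧ degA Fq α ≤ n ∧ HA Fq α ≤ (Fintype.card Fq : ℝ) ^ D}.Finite := by
  have hq := one_lt_q Fq
  have hfin : (⋃ P ∈ {P : Fq[X][X] | P.natDegree ≤ n ∧ ht Fq P ≤ D} \ {0},
      {α : K Fq | evalK Fq P α = 0}).Finite := by
    refine Set.Finite.biUnion ((finite_poly Fq n D).sdiff) ?_
    rintro P ⟨_, hP⟩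
    exact finite_roots Fq hP
  refine hfin.subset ?_
  rintro α ⟨h1, h2, h3⟩
  obtain ⟨P, hP, hPd, hPe, hPh⟩ := exists_min Fq h1
  rw [hPh, HP_eq] at h3
  simp only [Set.mem_iUnion]
  exact ⟨P, ⟨⟨by omega, (pow_le_pow_iff_right₀ hq).mp h3⟩, hP⟩, hPe⟩

/-! ### Minkowski's theorem -/

lemma gauss_le_HP (P : Fq[X][X]) : (P.map (emb Fq)).gaussNorm (vK Fq) 1 ≤ HP Fq P := by
  by_cases hP : P = 0
  · rw [hP, Polynomial.map_zero, gaussNorm_zero]; exact zero_le_one.trans (one_le_HP Fq 0)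
  · exact (HP_eq_gauss Fq hP).ge

lemma evalK_le {P : Fq[X][X]} {n : ℕ} (hn : P.natDegree ≤ n) (x : K Fq) :
    absK Fq (evalK Fq P x) ≤ HP Fq P * max 1 (absK Fq x) ^ n := by
  have := eval_le_gauss (vK_na Fq) (R := P.map (emb Fq)) (natDegree_map_le.trans hn) x
  rw [eval_map] at this
  refine this.trans ?_
  exact mul_le_mul_of_nonneg_right (gauss_le_HP Fq P) (by positivity)

lemma exists_C (ξ : K Fq) : ∃ C : ℕ, max 1 (absK Fq ξ) ≤ (Fintype.card Fq : ℝ) ^ C := by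
  obtain ⟨C, hC⟩ := pow_unbounded_of_one_lt (max 1 (absK Fq ξ)) (one_lt_q Fq)
  exact ⟨C, hC.le⟩

/-- The polynomial with prescribed coefficients. -/
def mkP {n h : ℕ} (a : Fin (n + 1) → Fin h → Fq) : Fq[X][X] :=
  ∑ i : Fin (n + 1), monomial (i : ℕ) (∑ j : Fin h, monomial (j : ℕ) (a i j))

lemma coeff_mkP {n h : ℕ} (a : Fin (n + 1) → Fin h → Fq) (i j : ℕ) :
    ((mkP Fq a).coeff i).coeff j = if hi : i < n + 1 then if hj : j < h then a ⟨i, hi⟩ ⟨j, hj⟩ else 0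
      else 0 := by
  rw [mkP, finsetSum_coeff]
  simp only [coeff_monomial]
  split_ifs with hi hj
  · rw [Finset.sum_eq_single ⟨i, hi⟩, if_pos rfl, finsetSum_coeff, Finset.sum_eq_single ⟨j, hj⟩]
    · simp
    · intro b _ hb; rw [coeff_monomial, if_neg]; rintro rfl; exact hb rfl
    · simp
    · intro b _ hb; rw [if_neg]; rintro rfl; exact hb rfl
    · simp
  · rw [Finset.sum_eq_single ⟨i, hi⟩, if_pos rfl, finsetSum_coeff, Finset.sum_eq_zero]
    · intro b _; rw [coeff_monomial, if_neg]; have := b.2; omega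
    · intro b _ hb; rw [if_neg]; rintro rfl; exact hb rfl
    · simp
  · rw [Finset.sum_eq_zero, coeff_zero]
    intro b _; rw [if_neg]; have := b.2; omega

lemma minkowski (ξ : K Fq) {C : ℕ} (hC : max 1 (absK Fq ξ) ≤ (Fintype.card Fq : ℝ) ^ C) (n h : ℕ)
    (hh : 1 ≤ h) :
    ∃ R : Fq[X][X], R ≠ 0 ∧ R.natDegree ≤ n ∧ ht Fq R ≤ h - 1 ∧
      absK Fq (evalK Fq R ξ) ≤ (Fintype.card Fq : ℝ) ^ (-((n : ℤ) * h - n * C)) := by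
  have hq := one_lt_q Fq
  let φ : (Fin (n + 1) → Fin h → Fq) → (Fin ((n + 1) * h - 1) → Fq) := fun a t =>
    (evalK Fq (mkP Fq a) ξ).coeff ((t : ℤ) - (h - 1 + n * C))
  have hcard : Fintype.card (Fin ((n + 1) * h - 1) → Fq) <
      Fintype.card (Fin (n + 1) → Fin h → Fq) := by
    simp only [Fintype.card_pi, Finset.prod_const, Finset.card_univ, Fintype.card_fin, ← pow_mul]
    apply Nat.pow_lt_pow_right Fintype.one_lt_card
    rw [mul_comm h]
    have : 1 ≤ (n + 1) * h := Nat.mul_pos (by omega) hh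
    omega
  obtain ⟨a, b, hab, heq⟩ := Fintype.exists_ne_map_eq_of_card_lt φ hcard
  set R := mkP Fq a - mkP Fq b with hR
  have hRdeg : R.natDegree ≤ n := by
    rw [natDegree_le_iff_coeff_eq_zero]
    intro N hN
    ext j
    rw [hR, coeff_sub, coeff_sub, coeff_mkP, coeff_mkP, dif_neg (by omega), dif_neg (by omega)]
    simp
  have hRht : ht Fq R ≤ h - 1 := by
    apply ht_le
    intro i
    rw [natDegree_le_iff_coeff_eq_zero]
    intro j hj
    have hj' : ¬ j < h := by omega
    rw [hR, coeff_sub, coeff_sub, coeff_mkP, coeff_mkP]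
    simp [hj']
  refine ⟨R, ?_, hRdeg, hRht, ?_⟩
  · intro h0
    apply hab
    funext i j
    have h1 := congrArg (fun P : Fq[X][X] => (P.coeff i).coeff j) h0
    simp only [hR, coeff_sub, coeff_mkP, coeff_zero] at h1
    rw [dif_pos i.2, dif_pos j.2, dif_pos i.2, dif_pos j.2] at h1
    exact sub_eq_zero.mp h1
  · rw [absK_le_iff]
    intro j hj
    by_cases hj2 : j < -((h : ℤ) - 1 + n * C)
    · have h1 : absK Fq (evalK Fq R ξ) ≤ (Fintype.card Fq : ℝ) ^ (-(-((h : ℤ) - 1 + n * C))) := by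
        refine (evalK_le Fq hRdeg ξ).trans ?_
        calc _ ≤ (Fintype.card Fq : ℝ) ^ (h - 1) * ((Fintype.card Fq : ℝ) ^ C) ^ n := by
              refine mul_le_mul (pow_le_pow_right₀ hq.le hRht) (pow_le_pow_left₀ (by positivity) hC n)
                (by positivity) (by positivity)
          _ = _ := by
              rw [← pow_mul, ← pow_add, neg_neg, ← zpow_natCast]
              congr 1
              push_cast [Nat.cast_sub hh]; ring
      exact (absK_le_iff Fq _ _).mp h1 j hj2
    · push Not at hj2
      obtain ⟨t, ht⟩ := Int.eq_ofNat_of_zero_le (a := j + (h - 1 + n * C)) (by linarith)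
      have hpos : 1 ≤ (n + 1) * h := Nat.mul_pos (by omega) hh
      have htlt : t < (n + 1) * h - 1 := by
        zify [hpos]
        rw [← ht]; linarith
      have := congrFun heq ⟨t, htlt⟩
      simp only [φ] at this
      rw [← ht, add_sub_cancel_right] at this
      rw [hR, evalK, eval₂_sub, HahnSeries.coeff_sub, sub_eq_zero]
      exact this


/-! ### Membership criteria -/

lemma mem_wnstarSet_of (ξ : K Fq) (n : ℕ) (w : ℝ)
    (h : ∀ ε : ℝ, 0 < ε → ∃ α : K Fq, IsAlgK Fq α ∧ degA Fq α ≤ n ∧ 0 < absK Fq (ξ - α) ∧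
      absK Fq (ξ - α) < HA Fq α ^ (-w - 1) ∧ absK Fq (ξ - α) < ε) : w ∈ wnstarSet Fq ξ n := by
  intro hfin
  obtain ⟨α, h1, h2, h3, h4, -⟩ := h 1 one_pos
  obtain ⟨α0, hα0, hmin⟩ := Set.exists_min_image _ (fun α => absK Fq (ξ - α)) hfin
    ⟨α, h1, h2, h3, h4⟩
  obtain ⟨β, h1, h2, h3, h4, h5⟩ := h _ hα0.2.2.1
  exact absurd (hmin β ⟨h1, h2, h3, h4⟩) (not_le.mpr h5)

lemma exists_approx {ξ : K Fq} {n : ℕ} {w : ℝ} (h : w ∈ wnstarSet Fq ξ n) (D : ℕ) :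
    ∃ α : K Fq, IsAlgK Fq α ∧ degA Fq α ≤ n ∧ 0 < absK Fq (ξ - α) ∧
      absK Fq (ξ - α) < HA Fq α ^ (-w - 1) ∧ (Fintype.card Fq : ℝ) ^ D < HA Fq α := by
  have h1 : ({α : K Fq | IsAlgK Fq α ∧ degA Fq α ≤ n ∧ 0 < absK Fq (ξ - α) ∧
      absK Fq (ξ - α) < HA Fq α ^ (-w - 1)} \
      {α : K Fq | IsAlgK Fq α ∧ degA Fq α ≤ n ∧ HA Fq α ≤ (Fintype.card Fq : ℝ) ^ D}).Infinite :=
    Set.Infinite.sdiff h (northcott Fq n D)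
  obtain ⟨α, ⟨a1, a2, a3, a4⟩, a5⟩ := h1.nonempty
  refine ⟨α, a1, a2, a3, a4, ?_⟩
  by_contra h6
  exact a5 ⟨a1, a2, not_lt.mp h6⟩

lemma rpow_small {w ε : ℝ} (hw : -1 < w) (hε : 0 < ε) :
    ∃ D : ℕ, ∀ H : ℝ, (Fintype.card Fq : ℝ) ^ D < H → H ^ (-w - 1) < ε := by
  have hq := one_lt_q Fq
  have h1 : Filter.Tendsto (fun H : ℝ => H ^ (-w - 1)) Filter.atTop (nhds 0) := by
    have := tendsto_rpow_neg_atTop (y := w + 1) (by linarith)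
    rwa [neg_add'] at this
  obtain ⟨H0, hH0⟩ := Filter.eventually_atTop.mp (h1.eventually (gt_mem_nhds hε))
  obtain ⟨D, hD⟩ := pow_unbounded_of_one_lt H0 hq
  exact ⟨D, fun H hH => hH0 H (hD.le.trans hH.le)⟩

lemma neg_one_mem (ξ : K Fq) {n : ℕ} (hn : 1 ≤ n) : (-1 : ℝ) ∈ wnstarSet Fq ξ n := by
  obtain ⟨c, hC⟩ := exists_C Fq ξ
  have hC' : absK Fq ξ ≤ (Fintype.card Fq : ℝ) ^ (-(-(c : ℤ))) := by
    rw [neg_neg, zpow_natCast]; exact (le_max_right _ _).trans hC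
  rw [absK_le_iff] at hC'
  let A : Fq[X] := ∑ j ∈ Finset.range (c + 1), monomial j (ξ.coeff (-(j : ℤ)))
  have hA : ∀ j : ℕ, A.coeff j = ξ.coeff (-(j : ℤ)) := by
    intro j
    simp only [A, finsetSum_coeff, coeff_monomial]
    rw [Finset.sum_ite_eq']
    split_ifs with h
    · rfl
    · rw [hC']
      rw [Finset.mem_range] at h
      omega
  let f : ℕ → K Fq := fun k => emb Fq A + HahnSeries.single (k + 1 : ℤ) 1
  have hf : Function.Injective f := by
    intro a b hab
    have h1 := add_left_cancel hab
    have h2 := congrArg (fun x : K Fq => x.coeff (a + 1)) h1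
    by_contra hne
    simp only [HahnSeries.coeff_single] at h2
    rw [if_pos trivial, if_neg (by omega)] at h2
    exact one_ne_zero h2
  have hinf : (Set.range f \ {ξ}).Infinite :=
    (Set.infinite_range_of_injective hf).sdiff (Set.finite_singleton ξ)
  refine hinf.mono ?_
  rintro _ ⟨⟨k, rfl⟩, hk⟩
  have hTk : Tvar Fq ^ (k + 1) * HahnSeries.single (k + 1 : ℤ) 1 = 1 := by
    rw [Tvar_pow, HahnSeries.single_mul_single]
    push_cast
    rw [neg_add_cancel, one_mul]; rfl
  let P : Fq[X][X] := C (X ^ (k + 1)) * X - C (A * X ^ (k + 1) + 1)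
  have hP0 : P ≠ 0 := by
    intro h
    have := congrArg (fun Q : Fq[X][X] => Q.coeff 1) h
    simp only [P, coeff_sub, coeff_C_mul, coeff_X_one, mul_one, coeff_zero,
      coeff_C_of_ne_zero one_ne_zero, sub_zero] at this
    exact pow_ne_zero _ X_ne_zero this
  have hPe : evalK Fq P (f k) = 0 := by
    simp only [P, evalK, eval₂_sub, eval₂_mul, eval₂_C, eval₂_X]
    simp only [map_add, map_mul, map_pow, emb_X, map_one, f, mul_add]
    rw [hTk]; ring
  have hPd : P.natDegree ≤ 1 := by
    simp only [P]
    refine (natDegree_sub_le _ _).trans ?_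
    rw [natDegree_C]
    rw [max_eq_left (Nat.zero_le _)]
    exact (natDegree_C_mul_le _ _).trans natDegree_X_le
  refine ⟨⟨P, hP0, hPe⟩, (degA_le Fq hP0 hPe).trans (hPd.trans hn), ?_, ?_⟩
  · apply absK_pos
    intro h
    exact hk (sub_eq_zero.mp h).symm
  · have h1 : absK Fq (ξ - f k) < (Fintype.card Fq : ℝ) ^ (-(0 : ℤ)) := by
      rw [absK_lt_succ_iff]
      intro j hj
      simp only [f, HahnSeries.coeff_sub, HahnSeries.coeff_add]
      rw [HahnSeries.coeff_single_of_ne (by omega), add_zero, coeff_emb]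
      rw [if_pos hj, hA, Int.toNat_of_nonneg (by omega), neg_neg, sub_self]
    simpa using h1

lemma easy (p : ℕ) [Fact p.Prime] [CharP Fq p] {ξ : K Fq} {n : ℕ} {w : ℝ} (hw : -1 ≤ w)
    (h : w ∈ wnstarSet Fq ξ n) : w ∈ wnstarSet Fq (ξ ^ p) n := by
  have hp : p ≠ 0 := (Fact.out : p.Prime).ne_zero
  have h1 := Set.Infinite.image (f := fun x : K Fq => x ^ p)
    (frobenius_inj (K Fq) p).injOn h
  refine h1.mono ?_
  rintro _ ⟨α, ⟨a1, a2, a3, a4⟩, rfl⟩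
  obtain ⟨P, hP, hPd, hPe, hPH⟩ := exists_min Fq a1
  have ht0 := tw_ne_zero Fq p hP
  have hte : evalK Fq (tw Fq p P) (α ^ p) = 0 := by rw [evalK_tw, hPe, zero_pow hp]
  have halg : IsAlgK Fq (α ^ p) := ⟨_, ht0, hte⟩
  have heq : absK Fq (ξ ^ p - α ^ p) = absK Fq (ξ - α) ^ p := by
    rw [← absK_pow, sub_pow_char]
  have hHA : HA Fq (α ^ p) ≤ HA Fq α ^ p := by
    refine (HA_le Fq ht0 hte).trans ?_
    rw [hPH, HP_eq, HP_eq, ← pow_mul, mul_comm]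
    exact pow_le_pow_right₀ (one_lt_q Fq).le (ht_tw Fq p P)
  have h1a := one_le_HA Fq a1
  refine ⟨halg, ?_, ?_, ?_⟩
  · refine (degA_le Fq ht0 hte).trans ?_
    rw [natDegree_tw, hPd]; exact a2
  · show 0 < absK Fq (ξ ^ p - α ^ p)
    rw [heq]; positivity
  · show absK Fq (ξ ^ p - α ^ p) < HA Fq (α ^ p) ^ (-w - 1)
    rw [heq]
    calc _ < (HA Fq α ^ (-w - 1)) ^ p := pow_lt_pow_left₀ a4 a3.le hp
      _ = (HA Fq α ^ p) ^ (-w - 1) := by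
          rw [← Real.rpow_natCast, ← Real.rpow_natCast, ← Real.rpow_mul (by positivity),
            ← Real.rpow_mul (by positivity), mul_comm]
      _ ≤ _ := Real.rpow_le_rpow_of_nonpos (zero_lt_one.trans_le (one_le_HA Fq halg)) hHA (by linarith)

/-! ### Transcendental (or high degree) case -/

lemma Dom_eventually {F : (K Fq)[X]} (h0 : F.coeff 0 ≠ 0) :
    ∀ᶠ ρ : ℝ in nhdsWithin 0 (Set.Ioi 0), Dom (vK Fq) F ρ := by
  have h1 : ∀ k ∈ Finset.Icc 1 F.natDegree, ∀ᶠ ρ : ℝ in nhdsWithin 0 (Set.Ioi 0),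
      vK Fq (F.coeff k) * ρ ^ k < vK Fq (F.coeff 0) := by
    intro k hk
    apply Filter.Eventually.filter_mono nhdsWithin_le_nhds
    have hc : Continuous fun ρ : ℝ => vK Fq (F.coeff k) * ρ ^ k := by fun_prop
    have := hc.tendsto 0
    rw [zero_pow (by rw [Finset.mem_Icc] at hk; omega), mul_zero] at this
    exact this.eventually (gt_mem_nhds ((vK Fq).pos h0))
  rw [← Filter.eventually_all_finset] at h1
  filter_upwards [h1] with ρ hρ k hk
  by_cases hkn : k ≤ F.natDegree
  · exact hρ k (Finset.mem_Icc.mpr ⟨hk, hkn⟩)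
  · rw [coeff_eq_zero_of_natDegree_lt (by omega), map_zero, zero_mul]
    exact (vK Fq).pos h0

lemma small_poly {ξ : K Fq} {n : ℕ}
    (hξ : ∀ F : Fq[X][X], F ≠ 0 → F.natDegree ≤ n → evalK Fq F ξ ≠ 0) (D : ℕ) :
    ∀ᶠ ρ : ℝ in nhdsWithin 0 (Set.Ioi 0), ∀ F ∈ {P : Fq[X][X] | P.natDegree ≤ n ∧ ht Fq P ≤ D},
      F ≠ 0 → Dom (vK Fq) (Tay Fq ξ F) ρ := by
  rw [Filter.eventually_all_finite (finite_poly Fq n D)]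
  rintro F ⟨h1, h2⟩
  by_cases hF : F = 0
  · simp [hF]
  · have := Dom_eventually Fq (F := Tay Fq ξ F) (by rw [Tay_coeff_zero]; exact hξ F hF h1)
    filter_upwards [this] with ρ hρ _ using hρ

lemma Dom_unit (ξ : K Fq) {F : Fq[X][X]} (hF : F ≠ 0) (h : F.natDegree = 0) (ρ : ℝ) :
    Dom (vK Fq) (Tay Fq ξ F) ρ := by
  rw [eq_C_of_natDegree_eq_zero h, Tay, map_C, taylor_C]
  apply dom_C
  intro h0
  rw [eq_C_of_natDegree_eq_zero h, emb_injective Fq (h0.trans (map_zero _).symm), C_0] at hF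
  exact hF rfl

lemma Dom_map {L : Type} [Field L] [Algebra (K Fq) L] {vL : AbsoluteValue L ℝ}
    (hvL : ∀ x : K Fq, vL (algebraMap (K Fq) L x) = absK Fq x) (F : (K Fq)[X]) (ρ : ℝ) :
    Dom vL (F.map (algebraMap (K Fq) L)) ρ ↔ Dom (vK Fq) F ρ := by
  simp only [Dom, coeff_map, hvL, vK_apply]

lemma Iso_map {L : Type} [Field L] [Algebra (K Fq) L] {vL : AbsoluteValue L ℝ}
    (hvL : ∀ x : K Fq, vL (algebraMap (K Fq) L x) = absK Fq x) (F : (K Fq)[X]) (ρ : ℝ) :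
    Iso vL (F.map (algebraMap (K Fq) L)) ρ ↔ Iso (vK Fq) F ρ := by
  simp only [Iso, coeff_map, hvL, vK_apply]

lemma gauss_map_le {L : Type} [Field L] [Algebra (K Fq) L] {vL : AbsoluteValue L ℝ}
    (hvL : ∀ x : K Fq, vL (algebraMap (K Fq) L x) = absK Fq x) (P : Fq[X][X]) :
    ((P.map (emb Fq)).map (algebraMap (K Fq) L)).gaussNorm vL 1 ≤ HP Fq P := by
  obtain ⟨i, hi⟩ := exists_eq_gaussNorm vL 1 ((P.map (emb Fq)).map (algebraMap (K Fq) L))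
  rw [hi, coeff_map, hvL, one_pow, mul_one, coeff_map]
  refine (absK_emb_le Fq _).trans ?_
  exact pow_le_pow_right₀ (one_lt_q Fq).le (natDegree_coeff_le_ht Fq P i)

/-- Lower bound for resultants. -/
lemma one_le_res {L : Type} [Field L] [Algebra (K Fq) L] {vL : AbsoluteValue L ℝ}
    (hvL : ∀ x : K Fq, vL (algebraMap (K Fq) L x) = absK Fq x) {G R : Fq[X][X]}
    (hG : Irreducible G) (hd : G.natDegree ≠ 0) (hR : ¬ G ∣ R) :
    1 ≤ vL (resultant ((G.map (emb Fq)).map (algebraMap (K Fq) L))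
      ((R.map (emb Fq)).map (algebraMap (K Fq) L)) G.natDegree R.natDegree) := by
  rw [resultant_map_map, resultant_map_map, hvL]
  exact one_le_absK_emb Fq (resultant_ne_zero_of Fq hG hd hR)


lemma exists_root_near {ξ : K Fq} {n c : ℕ} (hC : max 1 (absK Fq ξ) ≤ (Fintype.card Fq : ℝ) ^ c)
    {ρ : ℝ} (hρ : 0 < ρ)
    (hsmall : ∀ F ∈ {P : Fq[X][X] | P.natDegree ≤ n ∧ ht Fq P ≤ n * c},
      F ≠ 0 → Dom (vK Fq) (Tay Fq ξ F) ρ)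
    {F : Fq[X][X]} (hF : F ≠ 0) (hFn : F.natDegree ≤ n) (hFD : ¬ Dom (vK Fq) (Tay Fq ξ F) ρ) :
    ∃ G : Fq[X][X], G ≠ 0 ∧ G.natDegree ≤ n ∧ ht Fq G ≤ ht Fq F ∧
      ∃ α : K Fq, evalK Fq G α = 0 ∧ absK Fq (ξ - α) ≤ ρ := by
  have hq := one_lt_q Fq
  have hne : {h | ∃ P : Fq[X][X], P ≠ 0 ∧ P.natDegree ≤ n ∧ ¬ Dom (vK Fq) (Tay Fq ξ P) ρ ∧
      h = ht Fq P}.Nonempty := ⟨_, F, hF, hFn, hFD, rfl⟩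
  obtain ⟨F0, hF0, hF0n, hF0D, hF0h⟩ := Nat.sInf_mem hne
  have hmin : ∀ P : Fq[X][X], P ≠ 0 → P.natDegree ≤ n → ¬ Dom (vK Fq) (Tay Fq ξ P) ρ →
      ht Fq F0 ≤ ht Fq P := by
    intro P h1 h2 h3
    rw [← hF0h]
    exact Nat.sInf_le ⟨P, h1, h2, h3, rfl⟩
  obtain ⟨G, hG, hGF, hGD⟩ := exists_irreducible_factor_with Fq
    (fun P => ¬ Dom (vK Fq) (Tay Fq ξ P) ρ) (by
      intro u hu h
      exact h (Dom_unit Fq ξ hu.ne_zero (natDegree_eq_zero_of_isUnit hu) ρ)) (by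
      intro A B _ _ h
      by_contra h'
      push Not at h'
      apply h
      rw [Tay_mul]
      exact Dom.mul (vK_na Fq) hρ h'.1 h'.2) F0 hF0 hF0D
  have hGn : G.natDegree ≤ n := (natDegree_le_of_dvd hGF hF0).trans hF0n
  have hG1 := ht_le_of_dvd Fq hF0 hGF
  have hG2 := hmin G hG.ne_zero hGn hGD
  have hGh : n * c < ht Fq G := by
    by_contra h
    exact hGD (hsmall G ⟨hGn, not_lt.mp h⟩ hG.ne_zero)
  have hGd : G.natDegree ≠ 0 := fun h => hGD (Dom_unit Fq ξ hG.ne_zero h ρ)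
  refine ⟨G, hG.ne_zero, hGn, hG1.trans (hmin F hF hFn hFD), ?_⟩
  obtain ⟨L, _, _, vL, _, hvna, hvL⟩ := exists_extension Fq
  set G' := (G.map (emb Fq)).map (algebraMap (K Fq) L) with hG'
  have hinj : Function.Injective ((algebraMap (K Fq) L).comp (emb Fq)) :=
    (algebraMap (K Fq) L).injective.comp (emb_injective Fq)
  have hG'0 : G' ≠ 0 := by
    rw [hG', Polynomial.map_map, Polynomial.map_ne_zero_iff hinj]; exact hG.ne_zero
  have hdeg : ∀ P : Fq[X][X], ((P.map (emb Fq)).map (algebraMap (K Fq) L)).natDegree = P.natDegree := by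
    intro P
    rw [Polynomial.map_map, natDegree_map_eq_of_injective hinj]
  have htay : ∀ P : Fq[X][X], taylor (algebraMap (K Fq) L ξ)
      ((P.map (emb Fq)).map (algebraMap (K Fq) L)) = (Tay Fq ξ P).map (algebraMap (K Fq) L) := by
    intro P
    rw [Tay, map_taylor]
  have hsplit : G'.Splits := IsAlgClosed.splits G'
  rcases trichotomy hvna hG'0 hsplit (algebraMap (K Fq) L ξ) hρ with h | h | ⟨a, b, S, hS, ha, hb⟩
  · rw [hG', htay, Dom_map Fq hvL] at h
    exact absurd h hGD
  · rw [hG', htay, Iso_map Fq hvL] at h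
    obtain ⟨δ, hδ, hδ0⟩ := hensel Fq _ ρ hρ.le h.1 h.2
    refine ⟨δ + ξ, by rwa [← Tay_eval], ?_⟩
    rw [absK_sub_comm, add_sub_cancel_right]; exact hδ
  · exfalso
    set h := ht Fq G with hh
    obtain ⟨R, hR0, hRn, hRh, hRξ⟩ := minkowski Fq ξ hC n h (by omega)
    have hRD : Dom (vK Fq) (Tay Fq ξ R) ρ := by
      by_contra hc
      have := hmin R hR0 hRn hc
      omega
    have hGR : ¬ G ∣ R := by
      intro hd
      have := ht_le_of_dvd Fq hR0 hd
      omega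
    set R' := (R.map (emb Fq)).map (algebraMap (K Fq) L) with hR'
    have hev : ∀ a : L, vL (a - algebraMap (K Fq) L ξ) ≤ ρ → vL (R'.eval a) ≤
        (Fintype.card Fq : ℝ) ^ (-((n : ℤ) * h - n * c)) := by
      intro a ha
      have h1 := Dom.eval_le hvna ((Dom_map Fq hvL _ _).mpr hRD) ha
      rw [coeff_map, hvL, Tay_coeff_zero, ← htay, taylor_eval, sub_add_cancel] at h1
      exact h1.trans hRξ
    have h1 := one_le_res Fq hvL hG hGd hGR
    have h2 := res_bound hvna hsplit (R := R') (e := R.natDegree) (hdeg R).le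
      (A := {a, b}) (S := S) (by simp [hS, Multiset.insert_eq_cons, Multiset.singleton_add])
    rw [hdeg G] at h2
    have h3 := h1.trans h2
    have hcard : Multiset.card S + 2 = G.natDegree := by
      rw [← hdeg G, ← hsplit.natDegree_eq_card_roots.symm, hS]; simp
    have hgR : R'.gaussNorm vL 1 ^ (Multiset.card S) ≤ (Fintype.card Fq : ℝ) ^ ((h - 1) * (n - 2)) := by
      rw [pow_mul]
      refine (pow_le_pow_left₀ (gauss_nonneg R') ((gauss_map_le Fq hvL R).trans
        (pow_le_pow_right₀ hq.le hRh)) _).trans ?_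
      exact pow_le_pow_right₀ (one_le_pow₀ hq.le) (by omega)
    have hgG : G'.gaussNorm vL 1 ^ R.natDegree ≤ (Fintype.card Fq : ℝ) ^ (h * n) := by
      rw [pow_mul]
      refine (pow_le_pow_left₀ (gauss_nonneg G') ((gauss_map_le Fq hvL G)) _).trans ?_
      exact pow_le_pow_right₀ (one_le_pow₀ hq.le) hRn
    have hRR : vL ((({a, b} : Multiset L).map R'.eval).prod) ≤
        (Fintype.card Fq : ℝ) ^ (-((n : ℤ) * h - n * c)) * (Fintype.card Fq : ℝ) ^ (-((n : ℤ) * h - n * c)) := by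
      have : (({a, b} : Multiset L).map R'.eval).prod = R'.eval a * R'.eval b := by
        simp
      rw [this, map_mul]
      exact mul_le_mul (hev a ha) (hev b hb) (vL.nonneg _) (by positivity)
    have h4 : (1 : ℝ) ≤ (Fintype.card Fq : ℝ) ^ (-((n : ℤ) * h - n * c)) *
        (Fintype.card Fq : ℝ) ^ (-((n : ℤ) * h - n * c)) * (Fintype.card Fq : ℝ) ^ ((h - 1) * (n - 2)) *
        (Fintype.card Fq : ℝ) ^ (h * n) := by
      refine h3.trans ?_
      have g1 := gauss_nonneg (v := vL) R'
      have g2 := gauss_nonneg (v := vL) G'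
      gcongr
    rw [← zpow_natCast, ← zpow_natCast, ← zpow_add₀ (by positivity), ← zpow_add₀ (by positivity),
      ← zpow_add₀ (by positivity), ← zpow_zero (Fintype.card Fq : ℝ), zpow_le_zpow_iff_right₀ hq] at h4
    have hn2 : 2 ≤ n := by omega
    push_cast [Nat.cast_sub (show 1 ≤ h by omega), Nat.cast_sub hn2] at h4
    have : (n : ℤ) * c < h := by exact_mod_cast hGh
    nlinarith

lemma Dom_eval_ne {F : (K Fq)[X]} {ρ : ℝ} (hF : Dom (vK Fq) F ρ) {x : K Fq} (hx : absK Fq x ≤ ρ) :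
    F.eval x ≠ 0 := by
  intro h0
  rw [eval_eq_sum_range, Finset.sum_range_succ', pow_zero, mul_one] at h0
  have h1 := na_sum_lt (vK_na Fq) (Finset.range F.natDegree)
    (fun k => F.coeff (k + 1) * x ^ (k + 1)) hF.pos (by
      intro k _
      refine lt_of_le_of_lt ?_ (hF (k + 1) (by omega))
      rw [map_mul, map_pow]
      exact mul_le_mul_of_nonneg_left (pow_le_pow_left₀ ((vK Fq).nonneg _) hx _) ((vK Fq).nonneg _))
  rw [eq_neg_of_add_eq_zero_left h0, AbsoluteValue.map_neg] at h1
  exact lt_irrefl _ h1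

section frob

variable (p : ℕ) [Fact p.Prime] [CharP Fq p]

lemma exists_cut_not_dom {ξ : K Fq} {P : Fq[X][X]} (h0 : evalK Fq P (ξ ^ p) ≠ 0) {ρ : ℝ} (hρ : 0 < ρ)
    (hP : ¬ Dom (vK Fq) (Tay Fq (ξ ^ p) P) (ρ ^ p)) :
    ∃ i, cutP Fq p i P ≠ 0 ∧ ¬ Dom (vK Fq) (Tay Fq ξ (cutP Fq p i P)) ρ := by
  have hp : 0 < p := (Fact.out : p.Prime).pos
  rw [Dom] at hP
  push Not at hP
  obtain ⟨k, hk, hPk⟩ := hP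
  simp only [vK_apply] at hPk
  rw [Tay_coeff_zero] at hPk
  have h0' := absK_pos Fq h0
  obtain ⟨i, hi, hmax⟩ := Finset.exists_max_image (Finset.range p)
    (fun i => absK Fq (Tvar Fq ^ i * ((Tay Fq ξ (cutP Fq p i P)).coeff k) ^ p))
    ⟨0, Finset.mem_range.mpr hp⟩
  have h1 : absK Fq ((Tay Fq (ξ ^ p) P).coeff k) ≤
      absK Fq (Tvar Fq ^ i * ((Tay Fq ξ (cutP Fq p i P)).coeff k) ^ p) := by
    rw [Tay_frob]
    exact na_sum_le (vK_na Fq) _ _ (absK_nonneg Fq _) hmax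
  have h2 : absK Fq (Tvar Fq ^ i * ((Tay Fq ξ (cutP Fq p i P)).coeff 0) ^ p) ≤
      absK Fq (evalK Fq P (ξ ^ p)) := by
    rw [← Tay_coeff_zero, Tay_frob]
    exact absK_sum_frob_le Fq p (fun i => (Tay Fq ξ (cutP Fq p i P)).coeff 0) (Finset.mem_range.mp hi)
  have h3 := h2.trans (hPk.trans (mul_le_mul_of_nonneg_right h1 (by positivity)))
  have hT : 0 < absK Fq (Tvar Fq ^ i) := by
    apply absK_pos
    apply pow_ne_zero
    rw [Tvar]
    exact HahnSeries.single_ne_zero one_ne_zero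
  refine ⟨i, ?_, ?_⟩
  · intro hc
    have h4 := hPk.trans (mul_le_mul_of_nonneg_right h1 (by positivity))
    rw [hc, Tay] at h4
    simp [absK_zero, hp.ne'] at h4
    linarith
  · intro hD
    have h4 := hD k hk
    simp only [vK_apply] at h4
    rw [absK_mul, absK_mul, mul_assoc, mul_le_mul_iff_right₀ hT, absK_pow, absK_pow,
      ← pow_mul ρ, mul_comm p k, pow_mul ρ, ← mul_pow] at h3
    exact absurd (le_of_pow_le_pow_left₀ hp.ne' (by have := absK_nonneg Fq ((Tay Fq ξ (cutP Fq p i P)).coeff k); positivity) h3) (not_le.mpr h4)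

lemma caseA {ξ : K Fq} {n : ℕ} {w : ℝ} (hw : -1 < w)
    (hξ : ∀ F : Fq[X][X], F ≠ 0 → F.natDegree ≤ n → evalK Fq F ξ ≠ 0)
    (h : w ∈ wnstarSet Fq (ξ ^ p) n) : w ∈ wnstarSet Fq ξ n := by
  have hp : 0 < p := (Fact.out : p.Prime).pos
  have hq := one_lt_q Fq
  apply mem_wnstarSet_of
  intro ε hε
  obtain ⟨c, hC⟩ := exists_C Fq ξ
  obtain ⟨ρ0, hρ0, hsub⟩ := mem_nhdsGT_iff_exists_Ioo_subset.mp (small_poly Fq hξ (n * c))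
  have hρ0' : 0 < ρ0 := hρ0
  have hη : 0 < min ρ0 ε := lt_min hρ0' hε
  obtain ⟨D, hD⟩ := rpow_small Fq hw (pow_pos hη p)
  obtain ⟨β, b1, b2, b3, b4, b5⟩ := exists_approx Fq h D
  obtain ⟨P, hP, hPd, hPe, hPH⟩ := exists_min Fq b1
  set s := absK Fq (ξ ^ p - β) with hs
  obtain ⟨ρ, hρ, hρs⟩ : ∃ ρ : ℝ, 0 < ρ ∧ ρ ^ p = s :=
    ⟨s ^ ((p : ℝ)⁻¹), Real.rpow_pos_of_pos b3 _, Real.rpow_inv_natCast_pow b3.le hp.ne'⟩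
  have hρη : ρ < min ρ0 ε := by
    refine lt_of_pow_lt_pow_left₀ p hη.le ?_
    rw [hρs]
    exact b4.trans (hD _ b5)
  have hP0 : evalK Fq P (ξ ^ p) ≠ 0 := by
    intro h0
    obtain ⟨i, hi, hci⟩ := exists_cutP_ne_zero Fq p hP
    exact hξ _ hci ((natDegree_cutP Fq p i P).trans (hPd.le.trans b2)) (evalK_cutP_of_root Fq p h0 hi)
  have hPD : ¬ Dom (vK Fq) (Tay Fq (ξ ^ p) P) (ρ ^ p) := by
    intro hDm
    rw [hρs] at hDm
    refine Dom_eval_ne Fq hDm (x := β - ξ ^ p) ?_ ?_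
    · rw [absK_sub_comm]
    · rw [Tay_eval, sub_add_cancel, hPe]
  obtain ⟨i, hci, hcD⟩ := exists_cut_not_dom Fq p hP0 hρ hPD
  obtain ⟨G, hG, hGn, hGh, α, hα, hαρ⟩ := exists_root_near Fq hC hρ
    (hsub ⟨hρ, hρη.trans_le (min_le_left _ _)⟩) hci
    ((natDegree_cutP Fq p i P).trans (hPd.le.trans b2)) hcD
  have halg : IsAlgK Fq α := ⟨G, hG, hα⟩
  have hHA : HA Fq α ^ p ≤ HA Fq β := by
    rw [hPH]
    refine (pow_le_pow_left₀ (zero_le_one.trans (one_le_HA Fq halg)) (HA_le Fq hG hα) p).trans ?_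
    rw [HP_eq, HP_eq, ← pow_mul]
    refine pow_le_pow_right₀ hq.le ?_
    rw [mul_comm]
    exact (Nat.mul_le_mul_left p hGh).trans (ht_cutP Fq p i P)
  have h1a := one_le_HA Fq halg
  refine ⟨α, halg, (degA_le Fq hG hα).trans hGn, ?_, ?_, ?_⟩
  · apply absK_pos
    intro h0
    rw [← sub_eq_zero.mp h0] at hα
    exact hξ G hG hGn hα
  · refine hαρ.trans_lt ?_
    refine lt_of_pow_lt_pow_left₀ p (by positivity) ?_
    rw [hρs]
    calc s < HA Fq β ^ (-w - 1) := b4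
      _ ≤ (HA Fq α ^ p) ^ (-w - 1) :=
        Real.rpow_le_rpow_of_nonpos (by positivity) hHA (by linarith)
      _ = _ := by
          rw [← Real.rpow_natCast, ← Real.rpow_natCast, ← Real.rpow_mul (by positivity),
            ← Real.rpow_mul (by positivity), mul_comm]
  · exact hαρ.trans_lt (hρη.trans_le (min_le_right _ _))

end frob


/-! ### Algebraic case -/

lemma Tay_coeff (ξ : K Fq) (P : Fq[X][X]) (k : ℕ) :
    (Tay Fq ξ P).coeff k = evalK Fq (hasseDeriv k P) ξ := by
  rw [Tay, taylor_coeff, evalK, ← eval_map]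
  congr 1
  ext1 j
  simp only [hasseDeriv_coeff, coeff_map, map_mul, map_natCast]

lemma Tay_coeff_le (ξ : K Fq) {P : Fq[X][X]} {n : ℕ} (hn : P.natDegree ≤ n) (k : ℕ) :
    absK Fq ((Tay Fq ξ P).coeff k) ≤ HP Fq P * max 1 (absK Fq ξ) ^ n := by
  rw [Tay_coeff]
  refine (evalK_le Fq (((natDegree_hasseDeriv_le P k).trans (Nat.sub_le _ _)).trans hn) ξ).trans ?_
  refine mul_le_mul_of_nonneg_right (HP_mono_of_ht Fq ?_) (by positivity)
  apply ht_le
  intro i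
  rw [hasseDeriv_coeff]
  refine natDegree_mul_le.trans ?_
  rw [natDegree_natCast, zero_add]
  exact natDegree_coeff_le_ht Fq P _

lemma Tay_add (ξ : K Fq) (P Q : Fq[X][X]) : Tay Fq ξ (P + Q) = Tay Fq ξ P + Tay Fq ξ Q := by
  rw [Tay, Polynomial.map_add, map_add]; rfl

/-- Liouville's inequality. -/
lemma liouville {ξ : K Fq} {n d : ℕ} {w : ℝ} (hw : -1 < w) {G : Fq[X][X]} (hG : Irreducible G)
    (hGξ : evalK Fq G ξ = 0) (hGd : G.natDegree ≤ d) (h : w ∈ wnstarSet Fq ξ n) :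
    w ≤ (d : ℝ) - 1 := by
  have hq := one_lt_q Fq
  by_contra hwd
  push Not at hwd
  have hG0 := natDegree_ne_zero_of_root Fq hG.ne_zero hGξ
  have hm : (1 : ℝ) ≤ max 1 (absK Fq ξ) := le_max_left _ _
  have hG1 := one_le_HP Fq G
  set K0 : ℝ := max 1 (absK Fq ξ) ^ n * HP Fq G ^ n with hK0
  have hK0p : 0 < K0 := by positivity
  obtain ⟨D1, hD1⟩ := rpow_small Fq (w := w - d) (ε := K0⁻¹) (by linarith) (by positivity)
  obtain ⟨D2, hD2⟩ := rpow_small Fq hw one_pos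
  obtain ⟨β, b1, b2, b3, b4, b5⟩ := exists_approx Fq h (max (max D1 D2) (ht Fq G))
  have hmono : ∀ D, D ≤ max (max D1 D2) (ht Fq G) → (Fintype.card Fq : ℝ) ^ D < HA Fq β := by
    intro D hD
    exact (pow_le_pow_right₀ hq.le hD).trans_lt b5
  have hs1 : absK Fq (ξ - β) < 1 := b4.trans (hD2 _ (hmono D2 (by omega)))
  have hK1 := hD1 _ (hmono D1 (by omega))
  have hGH : HP Fq G < HA Fq β := hmono (ht Fq G) (le_max_right _ _)
  obtain ⟨P0, hP0, hP0d, hP0e, hP0H⟩ := exists_min Fq b1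
  obtain ⟨P, hP, hPP0, hPe⟩ := exists_irreducible_root Fq hP0 hP0e
  have hPH : HA Fq β = HP Fq P := by
    apply le_antisymm (HA_le Fq hP.ne_zero hPe)
    rw [hP0H]
    exact HP_mono_of_ht Fq (ht_le_of_dvd Fq hP0 hPP0)
  have hPn : P.natDegree ≤ n := (natDegree_le_of_dvd hPP0 hP0).trans (hP0d.le.trans b2)
  have hGP : ¬ G ∣ P := by
    intro hd
    have h1 : P ∣ G := (hG.associated_of_dvd hP hd).symm.dvd
    have h2 := HP_mono_of_ht Fq (ht_le_of_dvd Fq hG.ne_zero h1)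
    linarith
  have hPξ : absK Fq (evalK Fq P ξ) ≤ HP Fq P * max 1 (absK Fq ξ) ^ n * absK Fq (ξ - β) := by
    have hnD : ¬ Dom (vK Fq) (Tay Fq ξ P) (absK Fq (ξ - β)) := by
      intro hDm
      refine Dom_eval_ne Fq hDm (x := β - ξ) ?_ ?_
      · rw [absK_sub_comm]
      · rw [Tay_eval, sub_add_cancel, hPe]
    rw [Dom] at hnD
    push Not at hnD
    obtain ⟨k, hk, hle⟩ := hnD
    simp only [vK_apply] at hle
    rw [Tay_coeff_zero] at hle
    refine hle.trans ?_
    refine mul_le_mul (Tay_coeff_le Fq ξ hPn k) ?_ (by positivity) ?_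
    · exact pow_le_of_le_one b3.le hs1.le (by omega)
    · have := one_le_HP Fq P
      positivity
  obtain ⟨L, _, _, vL, _, hvna, hvL⟩ := exists_extension Fq
  set G' := (G.map (emb Fq)).map (algebraMap (K Fq) L) with hG'
  have hinj : Function.Injective ((algebraMap (K Fq) L).comp (emb Fq)) :=
    (algebraMap (K Fq) L).injective.comp (emb_injective Fq)
  have hG'0 : G' ≠ 0 := by
    rw [hG', Polynomial.map_map, Polynomial.map_ne_zero_iff hinj]; exact hG.ne_zero
  have hdeg : ∀ P : Fq[X][X], ((P.map (emb Fq)).map (algebraMap (K Fq) L)).natDegree = P.natDegree := by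
    intro P
    rw [Polynomial.map_map, natDegree_map_eq_of_injective hinj]
  have hsplit : G'.Splits := IsAlgClosed.splits G'
  have hevm : ∀ P : Fq[X][X], ((P.map (emb Fq)).map (algebraMap (K Fq) L)).eval
      (algebraMap (K Fq) L ξ) = algebraMap (K Fq) L (evalK Fq P ξ) := by
    intro P
    rw [eval_map, eval₂_hom, eval_map, evalK]
  have hroot : algebraMap (K Fq) L ξ ∈ G'.roots := by
    rw [mem_roots hG'0, IsRoot, hevm, hGξ, map_zero]
  obtain ⟨S, hS⟩ := Multiset.exists_cons_of_mem hroot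
  have hcard : Multiset.card S + 1 = G.natDegree := by
    rw [← hdeg G, ← hsplit.natDegree_eq_card_roots.symm, hS]; simp
  have h1 := one_le_res Fq hvL hG hG0 hGP
  have h2 := res_bound hvna hsplit (R := (P.map (emb Fq)).map (algebraMap (K Fq) L))
    (e := P.natDegree) (hdeg P).le (A := {algebraMap (K Fq) L ξ}) (S := S)
    (by simp [hS, Multiset.singleton_add])
  rw [hdeg G] at h2
  have h3 := h1.trans h2
  rw [Multiset.map_singleton, Multiset.prod_singleton, hevm, hvL] at h3
  have hH1 := one_le_HP Fq P
  have h4 : (1 : ℝ) ≤ (HP Fq P * max 1 (absK Fq ξ) ^ n * absK Fq (ξ - β)) * HP Fq P ^ (d - 1) *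
      HP Fq G ^ n := by
    refine h3.trans ?_
    have g1 := gauss_nonneg (v := vL) ((P.map (emb Fq)).map (algebraMap (K Fq) L))
    have g2 := gauss_nonneg (v := vL) G'
    have g3 := absK_nonneg Fq (evalK Fq P ξ)
    have e1 : ((P.map (emb Fq)).map (algebraMap (K Fq) L)).gaussNorm vL 1 ^ Multiset.card S ≤
        HP Fq P ^ (d - 1) :=
      (pow_le_pow_left₀ g1 (gauss_map_le Fq hvL P) _).trans (pow_le_pow_right₀ hH1 (by omega))
    have e2 : G'.gaussNorm vL 1 ^ P.natDegree ≤ HP Fq G ^ n :=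
      (pow_le_pow_left₀ g2 (gauss_map_le Fq hvL G) _).trans (pow_le_pow_right₀ hG1 hPn)
    gcongr
  have h5 : (HP Fq P * max 1 (absK Fq ξ) ^ n * absK Fq (ξ - β)) * HP Fq P ^ (d - 1) *
      HP Fq G ^ n = K0 * (HP Fq P ^ d * absK Fq (ξ - β)) := by
    obtain ⟨e, rfl⟩ : ∃ e, d = e + 1 := ⟨d - 1, by omega⟩
    rw [hK0, Nat.add_sub_cancel, pow_succ]; ring
  rw [h5] at h4
  rw [hPH] at b4 hK1
  have h6 : HP Fq P ^ d * absK Fq (ξ - β) < K0⁻¹ := by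
    refine lt_of_lt_of_le ?_ hK1.le
    have : HP Fq P ^ (-(w - d) - 1) = HP Fq P ^ d * HP Fq P ^ (-w - 1) := by
      rw [← Real.rpow_natCast, ← Real.rpow_add (by positivity)]
      congr 1; ring
    rw [this]
    exact mul_lt_mul_of_pos_left b4 (by positivity)
  have h7 := mul_lt_mul_of_pos_left h6 hK0p
  rw [mul_inv_cancel₀ hK0p.ne'] at h7
  linarith

lemma Tay_one_ne_zero (p : ℕ) [Fact p.Prime] [CharP Fq p] {ξ : K Fq} {M : Fq[X][X]} (hM : M ≠ 0) (hMξ : evalK Fq M ξ = 0)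
    (hMd : M.natDegree ≤ degA Fq ξ) : (Tay Fq ξ M).coeff 1 ≠ 0 := by
  have hp : p.Prime := Fact.out
  intro h0
  have hd0 := natDegree_ne_zero_of_root Fq hM hMξ
  rw [Tay_coeff, hasseDeriv_one] at h0
  have hder : derivative M = 0 := by
    by_contra hne
    have h1 := degA_le Fq hne h0
    have h2 := natDegree_derivative_lt hd0
    omega
  have hexp := expand_contract p hder hp.ne_zero
  set N := contract p M with hN
  have hN0 : N ≠ 0 := by
    intro h; rw [h, map_zero] at hexp; exact hM hexp.symm
  have hNe : evalK Fq N (ξ ^ p) = 0 := by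
    rw [evalK, ← eval_map, ← expand_eval, ← map_expand, hexp, eval_map]; exact hMξ
  have hNd : N.natDegree * p = M.natDegree := by rw [← natDegree_expand, hexp]
  obtain ⟨i, hi, hci⟩ := exists_cutP_ne_zero Fq p hN0
  have h1 := degA_le Fq hci (evalK_cutP_of_root Fq p hNe hi)
  have h2 := natDegree_cutP Fq p i N
  have h3 := hp.two_le
  have h4 : N.natDegree * 2 ≤ N.natDegree * p := Nat.mul_le_mul_left _ h3
  omega


lemma lower_bound (p : ℕ) [Fact p.Prime] [CharP Fq p] {ξ : K Fq} {n : ℕ} {w : ℝ}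
    (hξ : IsAlgK Fq ξ) (hdn : degA Fq ξ ≤ n) (hw : -1 ≤ w) (hwd : w < (degA Fq ξ : ℝ) - 1) :
    w ∈ wnstarSet Fq ξ n := by
  have hq := one_lt_q Fq
  obtain ⟨M, hM0, hMd, hMe, -⟩ := exists_min Fq hξ
  have hd0 := natDegree_ne_zero_of_root Fq hM0 hMe
  have hM1 := absK_pos Fq (Tay_one_ne_zero Fq p hM0 hMe hMd.le)
  set d := degA Fq ξ with hd
  set Q : ℝ := (Fintype.card Fq : ℝ) with hQ
  have hQ0 : 0 < Q := by linarith
  set m1 := absK Fq ((Tay Fq ξ M).coeff 1) with hm1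
  obtain ⟨c, hC⟩ := exists_C Fq ξ
  have hm : (1 : ℝ) ≤ max 1 (absK Fq ξ) := le_max_left _ _
  set B : ℝ := HP Fq M * max 1 (absK Fq ξ) ^ d with hB
  have hB1 : 1 ≤ B := one_le_mul_of_one_le_of_one_le (one_le_HP Fq M) (one_le_pow₀ hm)
  obtain ⟨e0, he0⟩ := pow_unbounded_of_one_lt (Q ^ (d * c) / m1) hq
  set e := e0 + d * c with he
  have he1 : Q ^ (d * c) < Q ^ e * m1 := by
    rw [div_lt_iff₀ hM1] at he0
    refine he0.trans_le (mul_le_mul_of_nonneg_right (pow_le_pow_right₀ hq.le (by omega)) hM1.le)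
  apply mem_wnstarSet_of
  intro ε hε
  -- choice of h
  obtain ⟨h, hh1, hhs, hhw⟩ : ∃ h : ℕ, 1 ≤ h ∧ (Q⁻¹) ^ h < min ε (m1 / B) ∧
      ((h : ℝ) + (e + ht Fq M : ℕ)) * (w + 1) < d * h := by
    have t1 : Filter.Tendsto (fun h : ℕ => (Q⁻¹) ^ h) Filter.atTop (nhds 0) :=
      tendsto_pow_atTop_nhds_zero_of_lt_one (by positivity) (inv_lt_one_of_one_lt₀ hq)
    have t2 := t1.eventually (gt_mem_nhds (lt_min hε (div_pos hM1 (by linarith : 0 < B))))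
    have t3 := (tendsto_natCast_atTop_atTop (R := ℝ)).eventually
      (Filter.eventually_gt_atTop (((e + ht Fq M : ℕ) : ℝ) * (w + 1) / (d - (w + 1))))
    obtain ⟨h, a1, a2, a3⟩ := ((Filter.eventually_ge_atTop 1).and (t2.and t3)).exists
    refine ⟨h, a1, a2, ?_⟩
    rw [div_lt_iff₀ (by linarith)] at a3
    linarith
  obtain ⟨S, hS0, hSn, hSh, hSξ⟩ := minkowski Fq ξ hC (d - 1) h hh1
  have hSe : evalK Fq S ξ ≠ 0 := by
    intro h0
    have := degA_le Fq hS0 h0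
    omega
  have hd1 : 1 ≤ d := by omega
  set ρ : ℝ := (Q⁻¹) ^ (d * h) with hρ
  have hρ0 : 0 < ρ := by positivity
  have hρh : ρ ≤ (Q⁻¹) ^ h :=
    pow_le_pow_of_le_one (by positivity) (inv_lt_one_of_one_lt₀ hq).le (Nat.le_mul_of_pos_left h hd1)
  have hρ1 : ρ ≤ 1 := pow_le_one₀ (by positivity) (inv_lt_one_of_one_lt₀ hq).le
  set F : Fq[X][X] := C (X ^ (h + e)) * M + S with hF
  have hFc : ∀ k, (Tay Fq ξ F).coeff k =
      emb Fq (X ^ (h + e)) * (Tay Fq ξ M).coeff k + (Tay Fq ξ S).coeff k := by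
    intro k
    rw [hF, Tay_add, Tay_mul, coeff_add]
    congr 1
    rw [Tay, map_C, taylor_C, coeff_C_mul]
  have hTe : absK Fq (emb Fq (X ^ (h + e))) = Q ^ (h + e) := by
    rw [absK_emb Fq (pow_ne_zero _ X_ne_zero), natDegree_X_pow]
  have hSk : ∀ k, absK Fq ((Tay Fq ξ S).coeff k) ≤ Q ^ (h + d * c) := by
    intro k
    refine (Tay_coeff_le Fq ξ (n := d) (by omega) k).trans ?_
    rw [pow_add]
    refine mul_le_mul (pow_le_pow_right₀ hq.le (hSh.trans (Nat.sub_le _ _))) ?_ (by positivity)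
      (by positivity)
    rw [mul_comm, pow_mul]
    exact pow_le_pow_left₀ (by positivity) hC d
  have hF1 : Q ^ (h + e) * m1 ≤ absK Fq ((Tay Fq ξ F).coeff 1) := by
    have h1 : emb Fq (X ^ (h + e)) * (Tay Fq ξ M).coeff 1 =
        (Tay Fq ξ F).coeff 1 + -(Tay Fq ξ S).coeff 1 := by rw [hFc]; ring
    have h2 := absK_add Fq ((Tay Fq ξ F).coeff 1) (-(Tay Fq ξ S).coeff 1)
    rw [← h1, absK_mul, hTe] at h2
    have h3 : absK Fq (-(Tay Fq ξ S).coeff 1) < Q ^ (h + e) * m1 := by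
      have : absK Fq (-(Tay Fq ξ S).coeff 1) = absK Fq ((Tay Fq ξ S).coeff 1) :=
        (vK Fq).map_neg _
      rw [this]
      refine (hSk 1).trans_lt ?_
      rw [pow_add, pow_add, mul_assoc]
      exact mul_lt_mul_of_pos_left he1 (by positivity)
    rcases le_max_iff.mp h2 with h4 | h4
    · exact h4
    · exact absurd h4 (not_le.mpr h3)
  have hF0 : (Tay Fq ξ F).coeff 0 = evalK Fq S ξ := by
    rw [hFc, Tay_coeff_zero, Tay_coeff_zero, hMe, mul_zero, zero_add]
  have hFξ : evalK Fq F ξ ≠ 0 := by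
    rw [← Tay_coeff_zero, hF0]; exact hSe
  have hFne : F ≠ 0 := by
    intro h0
    rw [h0, evalK, eval₂_zero] at hFξ
    exact hFξ rfl
  obtain ⟨δ, hδ, hδ0⟩ := hensel Fq (Tay Fq ξ F) ρ hρ0.le (by
    rw [hF0]
    refine le_trans ?_ (mul_le_mul_of_nonneg_right hF1 hρ0.le)
    refine hSξ.trans ?_
    have e1 : Q ^ (-(((d - 1 : ℕ) : ℤ) * h - ((d - 1 : ℕ) : ℤ) * c)) ≤ Q ^ (d * c) * (Q ^ h * ρ) := by
      rw [hρ, inv_pow, ← zpow_natCast, ← zpow_natCast, ← zpow_natCast, ← zpow_neg,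
        ← zpow_add₀ hQ0.ne', ← zpow_add₀ hQ0.ne', zpow_le_zpow_iff_right₀ hq]
      push_cast [Nat.cast_sub hd1]
      nlinarith
    refine e1.trans ?_
    calc _ ≤ (Q ^ e * m1) * (Q ^ h * ρ) := mul_le_mul_of_nonneg_right he1.le (by positivity)
      _ = _ := by rw [pow_add]; ring) (by
    intro k hk
    refine lt_of_lt_of_le ?_ hF1
    have h1 : absK Fq ((Tay Fq ξ F).coeff k) ≤ Q ^ (h + e) * B := by
      rw [hFc]
      refine (absK_add Fq _ _).trans (max_le ?_ ?_)
      · rw [absK_mul, hTe]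
        exact mul_le_mul_of_nonneg_left (Tay_coeff_le Fq ξ hMd.le k) (by positivity)
      · refine (hSk k).trans ?_
        refine (pow_le_pow_right₀ hq.le (by omega)).trans (le_mul_of_one_le_right (by positivity) hB1)
    have h2 : ρ ^ (k - 1) ≤ ρ := pow_le_of_le_one hρ0.le hρ1 (by omega)
    have h3 : B * ρ < m1 := by
      have := hρh.trans_lt (hhs.trans_le (min_le_right _ _))
      rw [lt_div_iff₀ (by linarith)] at this
      linarith
    calc _ ≤ (Q ^ (h + e) * B) * ρ :=
          mul_le_mul h1 h2 (by positivity) (by positivity)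
      _ = Q ^ (h + e) * (B * ρ) := by ring
      _ < _ := mul_lt_mul_of_pos_left h3 (by positivity))
  have hα : evalK Fq F (δ + ξ) = 0 := by rwa [← Tay_eval]
  have halg : IsAlgK Fq (δ + ξ) := ⟨F, hFne, hα⟩
  have hdist : absK Fq (ξ - (δ + ξ)) = absK Fq δ := by
    rw [absK_sub_comm, add_sub_cancel_right]
  have hFd : F.natDegree ≤ d := by
    rw [hF]
    refine (natDegree_add_le _ _).trans (max_le ?_ (by omega))
    exact (natDegree_C_mul_le _ _).trans hMd.le
  have hFh : ht Fq F ≤ h + (e + ht Fq M) := by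
    apply ht_le
    intro i
    rw [hF, coeff_add, coeff_C_mul]
    refine (natDegree_add_le _ _).trans (max_le ?_ ?_)
    · refine natDegree_mul_le.trans ?_
      have := natDegree_coeff_le_ht Fq M i
      rw [natDegree_X_pow]; omega
    · have := natDegree_coeff_le_ht Fq S i
      omega
  have hHA : HA Fq (δ + ξ) ≤ Q ^ (h + (e + ht Fq M)) :=
    (HA_le Fq hFne hα).trans (pow_le_pow_right₀ hq.le hFh)
  have h1a := one_le_HA Fq halg
  refine ⟨δ + ξ, halg, (degA_le Fq hFne hα).trans (hFd.trans hdn), ?_, ?_, ?_⟩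
  · rw [hdist]
    apply absK_pos
    rintro rfl
    rw [zero_add] at hα
    exact hFξ hα
  · rw [hdist]
    refine hδ.trans_lt ?_
    calc ρ = Q ^ (-((d : ℝ) * h)) := by
          rw [hρ, inv_pow, Real.rpow_neg hQ0.le, ← Real.rpow_natCast]; push_cast; rfl
      _ < Q ^ (((h : ℝ) + (e + ht Fq M : ℕ)) * (-w - 1)) := by
          rw [Real.rpow_lt_rpow_left_iff hq]; linarith
      _ = (Q ^ (h + (e + ht Fq M))) ^ (-w - 1) := by
          rw [← Real.rpow_natCast, ← Real.rpow_mul hQ0.le]; push_cast; rfl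
      _ ≤ _ := Real.rpow_le_rpow_of_nonpos (by positivity) hHA (by linarith)
  · rw [hdist]
    exact hδ.trans_lt (hρh.trans_lt (hhs.trans_le (min_le_left _ _)))

lemma le_wnstar {ξ : K Fq} {n : ℕ} {w : ℝ} (h : w ∈ wnstarSet Fq ξ n) :
    (w : EReal) ≤ wnstar Fq ξ n := le_sSup ⟨w, h, rfl⟩

lemma neg_one_le_wnstar (ξ : K Fq) {n : ℕ} (hn : 1 ≤ n) {w : ℝ} (hw : w ≤ -1) :
    (w : EReal) ≤ wnstar Fq ξ n :=
  le_trans (EReal.coe_le_coe_iff.mpr hw) (le_wnstar Fq (neg_one_mem Fq ξ hn))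

lemma wnstar_le (p : ℕ) [Fact p.Prime] [CharP Fq p] (ξ : K Fq) {n : ℕ} (hn : 1 ≤ n) :
    wnstar Fq ξ n ≤ wnstar Fq (ξ ^ p) n := by
  apply sSup_le
  rintro _ ⟨w, hw, rfl⟩
  by_cases h : w ≤ -1
  · exact neg_one_le_wnstar Fq _ hn h
  · exact le_wnstar Fq (easy Fq p (not_le.mp h).le hw)

lemma wnstar_ge (p : ℕ) [Fact p.Prime] [CharP Fq p] (ξ : K Fq) {n : ℕ} (hn : 1 ≤ n) :
    wnstar Fq (ξ ^ p) n ≤ wnstar Fq ξ n := by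
  apply sSup_le
  rintro _ ⟨w, hw, rfl⟩
  by_cases h : w ≤ -1
  · exact neg_one_le_wnstar Fq _ hn h
  push Not at h
  by_cases hξ : ∀ F : Fq[X][X], F ≠ 0 → F.natDegree ≤ n → evalK Fq F ξ ≠ 0
  · exact le_wnstar Fq (caseA Fq p h hξ hw)
  push Not at hξ
  obtain ⟨F, hF0, hFn, hFe⟩ := hξ
  have halg : IsAlgK Fq ξ := ⟨F, hF0, hFe⟩
  have hdn : degA Fq ξ ≤ n := (degA_le Fq hF0 hFe).trans hFn
  obtain ⟨M, hM0, hMd, hMe, -⟩ := exists_min Fq halg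
  have hte : evalK Fq (tw Fq p M) (ξ ^ p) = 0 := by
    rw [evalK_tw, hMe, zero_pow (Fact.out : p.Prime).ne_zero]
  have ht0 := tw_ne_zero Fq p hM0
  obtain ⟨G, hG, hGM, hGe⟩ := exists_irreducible_root Fq ht0 hte
  have hGd : G.natDegree ≤ degA Fq ξ := by
    refine (natDegree_le_of_dvd hGM ht0).trans ?_
    rw [natDegree_tw, hMd]
  have hwd := liouville Fq h hG hGe hGd hw
  refine le_of_forall_lt fun x hx => ?_
  obtain ⟨y, hxy, hyw⟩ := EReal.lt_iff_exists_real_btwn.mp hx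
  refine hxy.trans_le ?_
  by_cases hy : y ≤ -1
  · exact neg_one_le_wnstar Fq _ hn hy
  · exact le_wnstar Fq (lower_bound Fq p halg hdn (not_le.mp hy).le
      ((EReal.coe_lt_coe_iff.mp hyw).trans_le hwd))


/-- `w_n^*(ξ) = w_n^*(ξ^p)`. -/
theorem wnstar_frobenius (p : ℕ) [Fact p.Prime] (Fq : Type) [Field Fq] [Fintype Fq] [CharP Fq p]
    (ξ : K Fq) (n : ℕ) (hn : 1 ≤ n) :
    wnstar Fq ξ n = wnstar Fq (ξ ^ p) n := by
  exact le_antisymm (wnstar_le Fq p ξ hn) (wnstar_ge Fq p ξ hn)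

end
end MahlerKoksmaFq
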